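/- For every integer n ≥ 3 there exist a Ważewski dendrite X of order n and a finitely generated subgroup G of Homeo(X), dense in Homeo(X), whose natural action on the set Br of branch points of X is oligomorphic: for every m ≥ 1, the diagonal action of G on Br^m has only finitely many orbits. -/

import Mathlib

open Topology

/-- The set of connected components of a subset `S` of `X`. -/
def setComponents (X : Type*) [TopologicalSpace X] (S : Set X) : Set (Set X) :=
  {C | ∃ x ∈ S, C = connectedComponentIn S x}

/-- The order of a point `p` of `X`: the number of connected components of `X \ {p}`. -/
noncomputable def ptOrder (X : Type*) [TopologicalSpace X] (p : X) : ℕ :=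
  (setComponents X {p}ᶜ).ncard

/-- A dendrite: a nonempty, compact, connected, locally connected metrizable space
containing no subspace homeomorphic to the circle. -/
def IsDendrite (X : Type*) [TopologicalSpace X] : Prop :=
  Nonempty X ∧ CompactSpace X ∧ ConnectedSpace X ∧ LocallyConnectedSpace X ∧
    TopologicalSpace.MetrizableSpace X ∧
    ∀ S : Set X, IsEmpty (S ≃ₜ Circle)

/-- A Ważewski dendrite of order `n`: a dendrite all of whose points have order `1`, `2`
or `n`, and every arc (subspace homeomorphic to `[0,1]`) contains a point of order `n`. -/
def IsWazewskiDendrite (n : ℕ) (X : Type*) [TopologicalSpace X] : Prop :=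
  IsDendrite X ∧
  (∀ p : X, ptOrder X p = 1 ∨ ptOrder X p = 2 ∨ ptOrder X p = n) ∧
  ∀ A : Set X, Nonempty (A ≃ₜ unitInterval) → ∃ p ∈ A, ptOrder X p = n

/-- The group structure on self-homeomorphisms of `X`, with composition as product. -/
instance Homeomorph.instGroupSelf (X : Type*) [TopologicalSpace X] : Group (X ≃ₜ X) where
  mul f g := g.trans f
  one := Homeomorph.refl X
  inv := Homeomorph.symm
  mul_assoc _ _ _ := rfl
  one_mul _ := Homeomorph.ext fun _ => rfl
  mul_one _ := Homeomorph.ext fun _ => rfl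
  inv_mul_cancel := Homeomorph.self_trans_symm

/-- The compact-open topology on the group of self-homeomorphisms of `X` (for compact
metric `X`, this is the topology of uniform convergence). -/
instance Homeomorph.instTopSelf (X : Type*) [TopologicalSpace X] :
    TopologicalSpace (X ≃ₜ X) :=
  TopologicalSpace.induced (fun h : X ≃ₜ X => (h : C(X, X))) ContinuousMap.compactOpen


/-- Axiomatic self-similar model of the dendrite: `X` is the union of `N + 3` copies of itself,
glued together at the point `b`. -/
structure WModel (N : ℕ) (X : Type) [TopologicalSpace X] where
  ι : Fin (N + 3) → X → X
  a : X
  b : X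
  cont : ∀ i, Continuous (ι i)
  inj' : ∀ {i j x y}, ι i x = ι j y → (i = j ∧ x = y) ∨ (x = b ∧ y = b)
  surj : ∀ x, ∃ i y, x = ι i y
  ιb' : ∀ i j, ι i b = ι j b
  fixA : ι 0 a = a
  endA : ι 1 a = b
  hab : a ≠ b
  leb' : ∀ U K : Set X, IsOpen U → IsClosed K → K ⊆ U → ∃ k : ℕ, ∀ w : List (Fin (N + 3)),
    w.length = k → (∃ x, w.foldr ι x ∈ K) → ∀ x, w.foldr ι x ∈ U

namespace WModel

variable {N : ℕ} {X : Type} [TopologicalSpace X] (M : WModel N X)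

/-- The centre. -/
def c : X := M.ι 0 M.b

theorem ιb (i) : M.ι i M.b = M.c := M.ιb' i 0

def cell (w : List (Fin (N + 3))) (x : X) : X := w.foldr M.ι x

@[simp] theorem cell_nil (x : X) : M.cell [] x = x := rfl
@[simp] theorem cell_cons (i w) (x : X) : M.cell (i :: w) x = M.ι i (M.cell w x) := rfl

theorem leb (U K : Set X) (hU : IsOpen U) (hK : IsClosed K) (h : K ⊆ U) :
    ∃ k : ℕ, ∀ w : List (Fin (N + 3)),
    w.length = k → (∃ x, M.cell w x ∈ K) → ∀ x, M.cell w x ∈ U := M.leb' U K hU hK h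

theorem inj {i x y} (h : M.ι i x = M.ι i y) : x = y := by
  rcases M.inj' h with h | h
  · exact h.2
  · rw [h.1, h.2]

theorem inj_ne {i j x y} (hij : i ≠ j) (h : M.ι i x = M.ι j y) : x = M.b ∧ y = M.b := by
  rcases M.inj' h with h | h
  · exact absurd h.1 hij
  · exact h

theorem eq_c {i j x y} (hij : i ≠ j) (h : M.ι i x = M.ι j y) : M.ι i x = M.c := by
  rw [(M.inj_ne hij h).1, M.ιb]

theorem ι_eq_c {i x} : M.ι i x = M.c ↔ x = M.b := by
  constructor
  · intro h
    rw [← M.ιb i] at h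
    exact M.inj h
  · rintro rfl
    exact M.ιb i

theorem cell_surj (k : ℕ) (x : X) : ∃ w y, w.length = k ∧ x = M.cell w y := by
  induction k generalizing x with
  | zero => exact ⟨[], x, rfl, rfl⟩
  | succ k ih =>
    obtain ⟨i, y, rfl⟩ := M.surj x
    obtain ⟨w, z, hw, rfl⟩ := ih y
    exact ⟨i :: w, z, by simp [hw], rfl⟩

theorem cont_cell (w) : Continuous (M.cell w) := by
  induction w with
  | nil => exact continuous_id
  | cons i w ih => exact (M.cont i).comp ih

/-- Branch points. -/
inductive Br : X → Prop
  | c : Br M.c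
  | step (i) {x} : Br x → Br (M.ι i x)

theorem c_ne_b : M.c ≠ M.b := by
  intro h
  exact M.hab (M.inj ((M.ιb 1).trans (h.trans M.endA.symm))).symm

theorem c_ne_a : M.c ≠ M.a := by
  intro h
  exact M.hab (M.inj ((M.ιb 0).trans (h.trans M.fixA.symm))).symm

theorem Br.ne_a {M : WModel N X} {x} (h : M.Br x) : x ≠ M.a := by
  induction h with
  | c => exact M.c_ne_a
  | @step i x hx ih =>
    intro h
    rw [← M.fixA] at h
    rcases M.inj' h with h | h
    · exact ih h.2
    · exact M.hab h.2

theorem Br.ne_b {M : WModel N X} {x} (h : M.Br x) : x ≠ M.b := by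
  cases h with
  | c => exact M.c_ne_b
  | @step i x hx =>
    intro h
    rw [← M.endA] at h
    rcases M.inj' h with h | h
    · exact hx.ne_a h.2
    · exact M.hab h.2

theorem Br.of_ι {M : WModel N X} {i x} (h : M.Br (M.ι i x)) : M.Br x ∨ x = M.b := by
  generalize hy : M.ι i x = y at h
  cases h with
  | c => right; exact M.ι_eq_c.1 hy
  | @step j z hz =>
    rcases M.inj' hy with h | h
    · left; rw [h.2]; exact hz
    · right; exact h.1

theorem br_cell (w) : M.Br (M.cell w M.c) := by
  induction w with
  | nil => exact .c
  | cons i w ih => exact .step i ih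

theorem range_surj : (⋃ i, Set.range (M.ι i)) = Set.univ := by
  ext x
  obtain ⟨i, y, rfl⟩ := M.surj x
  simp only [Set.mem_iUnion, Set.mem_univ, iff_true]
  exact ⟨i, y, rfl⟩

theorem preconn (M : WModel N X) : IsPreconnected (Set.univ : Set X) := by
  rw [← preconnectedSpace_iff_univ, preconnectedSpace_iff_clopen]
  intro U hU
  obtain ⟨k, hk⟩ := M.leb U U hU.isOpen hU.isClosed subset_rfl
  have : ∀ k (V : Set X), (∀ w : List (Fin (N + 3)), w.length = k → (∃ x, M.cell w x ∈ V) →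
      ∀ x, M.cell w x ∈ V) → (∃ x, x ∈ V) → ∀ x, x ∈ V := by
    intro k
    induction k with
    | zero =>
      intro V h ⟨x, hx⟩ y
      exact h [] rfl ⟨x, hx⟩ y
    | succ k ih =>
      intro V h ⟨x, hx⟩ y
      have key : ∀ i, (∃ x, M.ι i x ∈ V) → ∀ x, M.ι i x ∈ V := fun i hi =>
        ih {x | M.ι i x ∈ V} (fun w hw => h (i :: w) (by simp [hw])) hi
      obtain ⟨i, x, rfl⟩ := M.surj x
      obtain ⟨j, y, rfl⟩ := M.surj y
      apply key
      refine ⟨M.b, ?_⟩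
      rw [M.ιb, ← M.ιb i]
      exact key i ⟨x, hx⟩ _
  rcases U.eq_empty_or_nonempty with h | h
  · exact Or.inl h
  · exact Or.inr (Set.eq_univ_of_forall (this k U hk h))

theorem preconn_cell (w) : IsPreconnected (Set.range (M.cell w)) := by
  rw [← Set.image_univ]
  exact M.preconn.image _ (M.cont_cell w).continuousOn

theorem preconn_ι (i) : IsPreconnected (Set.range (M.ι i)) := M.preconn_cell [i]

theorem c_mem_range (i) : M.c ∈ Set.range (M.ι i) := ⟨M.b, M.ιb i⟩

variable [CompactSpace X] [T2Space X]

theorem closed_ι (i) : IsClosed (Set.range (M.ι i)) := (isCompact_range (M.cont i)).isClosed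

theorem closed_cell (w) : IsClosed (Set.range (M.cell w)) :=
  (isCompact_range (M.cont_cell w)).isClosed

theorem isClosedEmb (i) : IsClosedEmbedding (M.ι i) :=
  (M.cont i).isClosedEmbedding fun _ _ h => M.inj h

theorem glue_aux {Y : Type} [TopologicalSpace Y] (F : Fin (N + 3) → X → Y)
    (hF : ∀ i, Continuous (F i)) (hb : ∀ i j, F i M.b = F j M.b) :
    ∃ f : X → Y, Continuous f ∧ ∀ i x, f (M.ι i x) = F i x := by
  choose g1 g2 hg using M.surj
  have key : ∀ i x, F (g1 (M.ι i x)) (g2 (M.ι i x)) = F i x := by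
    intro i x
    rcases M.inj' (hg (M.ι i x)) with h | h
    · rw [← h.1, ← h.2]
    · rw [h.2, h.1]; exact hb _ _
  refine ⟨fun x => F (g1 x) (g2 x), ?_, key⟩
  rw [continuous_iff_isClosed]
  intro C hC
  have : (fun x => F (g1 x) (g2 x)) ⁻¹' C = ⋃ i, M.ι i '' (F i ⁻¹' C) := by
    ext x
    simp only [Set.mem_preimage, Set.mem_iUnion, Set.mem_image]
    constructor
    · intro h
      exact ⟨g1 x, g2 x, h, (hg x).symm⟩
    · rintro ⟨i, y, hy, rfl⟩
      rw [key]
      exact hy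
  rw [this]
  exact isClosed_iUnion_of_finite fun i => (M.isClosedEmb i).isClosedMap _ (hC.preimage (hF i))

/-- Separation: a preconnected set meeting two different branches at `cell u c` contains it. -/
theorem sep (u) : ∀ {S : Set X}, IsPreconnected S → ∀ {i j x y}, i ≠ j →
    M.cell u (M.ι i x) ∈ S → M.cell u (M.ι j y) ∈ S → M.cell u M.c ∈ S := by
  induction u with
  | nil =>
    intro S hS i j x y hij hx hy
    have h1 : IsClosed (⋃ k : {k // k ≠ i}, Set.range (M.ι k)) :=
      isClosed_iUnion_of_finite fun k => M.closed_ι _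
    rw [isPreconnected_closed_iff] at hS
    have hcov : S ⊆ Set.range (M.ι i) ∪ ⋃ k : {k // k ≠ i}, Set.range (M.ι k) := by
      intro z _
      obtain ⟨k, q, rfl⟩ := M.surj z
      by_cases hk : k = i
      · left; exact ⟨q, by rw [hk]⟩
      · right; exact Set.mem_iUnion.2 ⟨⟨k, hk⟩, q, rfl⟩
    obtain ⟨z, hz, ⟨p, hp⟩, hz2⟩ := hS _ _ (M.closed_ι i) h1 hcov ⟨_, hx, x, rfl⟩
      ⟨_, hy, Set.mem_iUnion.2 ⟨⟨j, hij.symm⟩, y, rfl⟩⟩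
    obtain ⟨⟨k, hk⟩, q, hq⟩ := Set.mem_iUnion.1 hz2
    have := M.eq_c hk (hq.trans hp.symm)
    rw [hq] at this
    rw [M.cell_nil, ← this]
    exact hz
  | cons l u ih =>
    intro S hS i j x y hij hx hy
    obtain ⟨r, hr, hr2⟩ := M.glue_aux (fun k => if k = l then id else fun _ => M.b)
      (fun k => by split_ifs <;> fun_prop) (fun k k' => by split_ifs <;> rfl)
    have hl : ∀ z, r (M.ι l z) = z := fun z => by rw [hr2]; simp
    have := ih (hS.image r hr.continuousOn) (x := x) (y := y) hij
      ⟨_, hx, hl _⟩ ⟨_, hy, hl _⟩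
    obtain ⟨z, hz, hz2⟩ := this
    obtain ⟨k, z, rfl⟩ := M.surj z
    by_cases hk : k = l
    · subst hk
      rw [hl] at hz2
      rw [M.cell_cons, ← hz2]
      exact hz
    · rw [hr2, if_neg hk] at hz2
      exact absurd hz2.symm (M.br_cell u).ne_b

/-- Weak separation of distinct points. -/
theorem weak_sep {y z : X} (h : y ≠ z) : ∃ u i j y' z', i ≠ j ∧ y = M.cell u (M.ι i y') ∧
    z = M.cell u (M.ι j z') := by
  obtain ⟨k, hk⟩ := M.leb {z}ᶜ {y} isOpen_compl_singleton isClosed_singleton (by simpa using h.symm)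
  have hk2 : ∀ w : List (Fin (N + 3)), w.length = k → ∀ p q, y = M.cell w p → z ≠ M.cell w q := by
    intro w hw p q hp hq
    exact hk w hw ⟨p, hp.symm⟩ q hq.symm
  clear hk h
  induction k generalizing y z with
  | zero => exact absurd rfl (hk2 [] rfl y z rfl)
  | succ k ih =>
    obtain ⟨i, y, rfl⟩ := M.surj y
    obtain ⟨j, z, rfl⟩ := M.surj z
    by_cases hij : i = j
    · subst hij
      obtain ⟨u, k, l, y', z', h1, h2, h3⟩ := ih (y := y) (z := z) (by
        rintro w hw p q rfl rfl
        exact hk2 (i :: w) (by simp [hw]) p q rfl rfl)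
      exact ⟨i :: u, k, l, y', z', h1, by rw [h2]; rfl, by rw [h3]; rfl⟩
    · exact ⟨[], i, j, y, z, hij, rfl, rfl⟩

theorem exists_br {S : Set X} (hS : IsPreconnected S) {y z : X} (hy : y ∈ S) (hz : z ∈ S)
    (h : y ≠ z) : ∃ p ∈ S, M.Br p := by
  obtain ⟨u, i, j, y', z', hij, rfl, rfl⟩ := M.weak_sep h
  exact ⟨_, M.sep u hS hij hy hz, M.br_cell u⟩

theorem locConn (M : WModel N X) : LocallyConnectedSpace X := by
  rw [locallyConnectedSpace_iff_connectedComponentIn_open]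
  intro U hU x hx
  rw [isOpen_iff_mem_nhds]
  intro y hy
  have hyU := connectedComponentIn_subset _ _ hy
  obtain ⟨k, hk⟩ := M.leb U {y} hU isClosed_singleton (by simpa using hyU)
  have hfin : {w : List (Fin (N + 3)) | w.length = k}.Finite := List.finite_length_eq _ k
  have hV : IsClosed (⋃ w ∈ {w : List (Fin (N + 3)) | w.length = k ∧ y ∉ Set.range (M.cell w)},
      Set.range (M.cell w)) :=
    (hfin.subset fun w hw => hw.1).isClosed_biUnion fun w _ => M.closed_cell w
  refine Filter.mem_of_superset (hV.isOpen_compl.mem_nhds ?_) ?_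
  · simp only [Set.mem_compl_iff, Set.mem_iUnion, not_exists]
    intro w hw
    exact hw.2
  · intro z hz
    obtain ⟨w, z, hw, rfl⟩ := M.cell_surj k z
    have : y ∈ Set.range (M.cell w) := by
      by_contra hcon
      apply hz
      simp only [Set.mem_iUnion]
      exact ⟨w, ⟨hw, hcon⟩, z, rfl⟩
    rw [connectedComponentIn_eq hy]
    refine (M.preconn_cell w).subset_connectedComponentIn this ?_ ⟨z, rfl⟩
    rintro _ ⟨z', rfl⟩
    obtain ⟨y', hy'⟩ := this
    exact hk w hw ⟨y', hy'⟩ z'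

def Yc (M : WModel N X) : List (Fin (N + 3)) → Set X
  | [] => ∅
  | i :: w => (⋃ j : {j // j ≠ i}, Set.range (M.ι j)) ∪ M.ι i '' (Yc M w)

theorem Yc_union (w) (x : X) : x ∈ M.Yc w ∨ x ∈ Set.range (M.cell w) := by
  induction w generalizing x with
  | nil => right; exact ⟨x, rfl⟩
  | cons i w ih =>
    obtain ⟨j, y, rfl⟩ := M.surj x
    by_cases hj : j = i
    · subst hj
      rcases ih y with h | ⟨z, rfl⟩
      · left; right; exact ⟨y, h, rfl⟩
      · right; exact ⟨z, rfl⟩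
    · left; left
      exact Set.mem_iUnion.2 ⟨⟨j, hj⟩, y, rfl⟩

theorem Yc_inter (w) (x : X) (h1 : x ∈ M.Yc w) (h2 : x ∈ Set.range (M.cell w)) : M.Br x := by
  induction w generalizing x with
  | nil => exact h1.elim
  | cons i w ih =>
    obtain ⟨z, rfl⟩ := h2
    rcases h1 with h1 | ⟨y, hy, hyz⟩
    · obtain ⟨⟨j, hj⟩, y, hy⟩ := Set.mem_iUnion.1 h1
      rw [← hy, M.eq_c hj hy]
      exact .c
    · rw [← hyz]
      refine .step i (ih _ hy ?_)
      exact ⟨z, (M.inj hyz).symm⟩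

theorem b_cell (w : List (Fin (N + 3))) (hw : w ≠ []) :
    M.b ∈ M.Yc w ∨ M.b = M.cell w M.a := by
  have key : ∀ w, M.a ∈ M.Yc w ∨ M.a = M.cell w M.a := by
    intro w
    induction w with
    | nil => right; rfl
    | cons i w ih =>
      by_cases hi : i = 0
      · subst hi
        rcases ih with h | h
        · left; right; exact ⟨_, h, M.fixA⟩
        · right; rw [M.cell_cons, ← h, M.fixA]
      · left; left
        exact Set.mem_iUnion.2 ⟨⟨0, Ne.symm hi⟩, M.a, M.fixA⟩
  cases w with
  | nil => exact absurd rfl hw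
  | cons i w =>
    by_cases hi : i = 1
    · subst hi
      rcases key w with h | h
      · left; right; exact ⟨_, h, M.endA⟩
      · right; rw [M.cell_cons, ← h, M.endA]
    · left; left
      exact Set.mem_iUnion.2 ⟨⟨1, Ne.symm hi⟩, M.a, M.endA⟩

theorem Yc_conn (w) (y : X) (hy : y ∈ M.Yc w) : ∃ C ⊆ M.Yc w, IsPreconnected C ∧ y ∈ C ∧
    (M.cell w M.a ∈ C ∨ M.cell w M.b ∈ C) := by
  induction w generalizing y with
  | nil => exact hy.elim
  | cons i w ih =>
    rcases hy with hy | ⟨y, hy, rfl⟩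
    · have h1 : IsPreconnected (⋃ j : {j // j ≠ i}, Set.range (M.ι j)) :=
        isPreconnected_iUnion ⟨M.c, Set.mem_iInter.2 fun j => M.c_mem_range _⟩
          fun j => M.preconn_ι _
      have h2 : M.ι i M.b ∈ (⋃ j : {j // j ≠ i}, Set.range (M.ι j)) := by
        obtain ⟨⟨j, hj⟩, _⟩ := Set.mem_iUnion.1 hy
        rw [M.ιb, Set.mem_iUnion]
        exact ⟨⟨j, hj⟩, M.c_mem_range _⟩
      by_cases hw : w = []
      · subst hw
        exact ⟨_, Set.subset_union_left, h1, hy, Or.inr h2⟩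
      rcases M.b_cell w hw with hb | hb
      · obtain ⟨C, hC, hC1, hC2, hC3⟩ := ih _ hb
        refine ⟨_ ∪ M.ι i '' C, Set.union_subset_union_right _ (Set.image_mono hC),
          h1.union (M.ι i M.b) h2 ⟨_, hC2, rfl⟩ (hC1.image _ (M.cont i).continuousOn),
          Or.inl hy, ?_⟩
        rcases hC3 with h | h
        · exact Or.inl (Or.inr ⟨_, h, rfl⟩)
        · exact Or.inr (Or.inr ⟨_, h, rfl⟩)
      · refine ⟨_, Set.subset_union_left, h1, hy, Or.inl ?_⟩
        rw [M.cell_cons, ← hb]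
        exact h2
    · obtain ⟨C, hC, hC1, hC2, hC3⟩ := ih _ hy
      refine ⟨M.ι i '' C, (Set.image_mono hC).trans Set.subset_union_right,
        hC1.image _ (M.cont i).continuousOn, ⟨_, hC2, rfl⟩, ?_⟩
      rcases hC3 with h | h
      · exact Or.inl ⟨_, h, rfl⟩
      · exact Or.inr ⟨_, h, rfl⟩

theorem eventually_Yc {x p : X} (hx : x ≠ p) : ∃ k, ∀ w : List (Fin (N + 3)), w.length = k →
    p ∈ Set.range (M.cell w) → x ∈ M.Yc w := by
  obtain ⟨k, hk⟩ := M.leb {x}ᶜ {p} isOpen_compl_singleton isClosed_singleton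
    (by simpa using hx)
  refine ⟨k, fun w hw ⟨q, hq⟩ => ?_⟩
  rcases M.Yc_union w x with h | ⟨z, hz⟩
  · exact h
  · exact absurd hz (hk w hw ⟨q, hq⟩ z)

theorem Yc_append (u w) : M.Yc u ⊆ M.Yc (u ++ w) := by
  induction u with
  | nil => exact fun _ h => h.elim
  | cons i u ih => exact Set.union_subset_union_right _ (Set.image_mono ih)

theorem cell_append (u w) (x : X) : M.cell (u ++ w) x = M.cell u (M.cell w x) := by
  simp [cell]

theorem eventually_Yc' {x p : X} (hx : x ≠ p) : ∃ k, ∀ w : List (Fin (N + 3)), k ≤ w.length →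
    p ∈ Set.range (M.cell w) → x ∈ M.Yc w := by
  obtain ⟨k, hk⟩ := M.eventually_Yc hx
  refine ⟨k, fun w hw ⟨q, hq⟩ => ?_⟩
  rw [← List.take_append_drop k w] at hq ⊢
  rw [M.cell_append] at hq
  exact M.Yc_append _ _ (hk _ (by simp [hw]) ⟨_, hq⟩)

theorem preconn_compl_b (M : WModel N X) : IsPreconnected ({M.b}ᶜ : Set X) := by
  apply isPreconnected_of_forall_pair
  intro x hx y hy
  obtain ⟨k1, h1⟩ := M.eventually_Yc' hx
  obtain ⟨k2, h2⟩ := M.eventually_Yc' hy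
  have ha : ∀ k, M.cell (List.replicate k 0) M.a = M.a := by
    intro k
    induction k with
    | zero => rfl
    | succ k ih => rw [List.replicate_succ, M.cell_cons, ih, M.fixA]
  set w : List (Fin (N + 3)) := 1 :: List.replicate (k1 + k2) 0 with hw
  have hb : M.cell w M.a = M.b := by rw [hw, M.cell_cons, ha, M.endA]
  have hbr : M.b ∈ Set.range (M.cell w) := ⟨_, hb⟩
  have hbY : M.b ∉ M.Yc w := fun h => (M.Yc_inter w _ h hbr).ne_b rfl
  have key : ∀ z, z ∈ M.Yc w → ∃ C ⊆ ({M.b}ᶜ : Set X), IsPreconnected C ∧ z ∈ C ∧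
      M.cell w M.b ∈ C := by
    intro z hz
    obtain ⟨C, hC, hC1, hC2, hC3⟩ := M.Yc_conn w z hz
    rw [hb] at hC3
    refine ⟨C, ?_, hC1, hC2, hC3.resolve_left fun h => hbY (hC h)⟩
    rintro p hp rfl
    exact hbY (hC hp)
  obtain ⟨C, hC, hC1, hC2, hC3⟩ := key x (h1 w (by simp [hw]; omega) hbr)
  obtain ⟨D, hD, hD1, hD2, hD3⟩ := key y (h2 w (by simp [hw]; omega) hbr)
  exact ⟨C ∪ D, Set.union_subset hC hD, Or.inl hC2, Or.inr hD2, hC1.union _ hC3 hD3 hD1⟩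

theorem ptOrder_c (M : WModel N X) : ptOrder X M.c = N + 3 := by
  have key : ∀ i x, x ≠ M.b →
      connectedComponentIn ({M.c}ᶜ : Set X) (M.ι i x) = M.ι i '' {M.b}ᶜ := by
    intro i x hx
    have hxc : M.ι i x ∈ ({M.c}ᶜ : Set X) := fun h => hx (M.ι_eq_c.1 h)
    apply subset_antisymm
    · intro z hz
      obtain ⟨j, z, rfl⟩ := M.surj z
      have hzc := connectedComponentIn_subset _ _ hz
      by_cases hij : i = j
      · subst hij
        refine ⟨z, fun h => hzc ?_, rfl⟩
        exact M.ι_eq_c.2 h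
      · exfalso
        have := M.sep [] (isPreconnected_connectedComponentIn (x := M.ι i x)
          (F := ({M.c}ᶜ : Set X))) hij (mem_connectedComponentIn hxc) hz
        exact connectedComponentIn_subset _ _ this rfl
    · refine ((M.preconn_compl_b).image _ (M.cont i).continuousOn).subset_connectedComponentIn
        ⟨x, hx, rfl⟩ ?_
      rintro _ ⟨z, hz, rfl⟩ h
      exact hz (M.ι_eq_c.1 h)
  have : setComponents X {M.c}ᶜ = Set.range fun i => M.ι i '' {M.b}ᶜ := by
    ext C
    constructor
    · rintro ⟨x, hx, rfl⟩
      obtain ⟨i, x, rfl⟩ := M.surj x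
      exact ⟨i, (key i x fun h => hx (M.ι_eq_c.2 h)).symm⟩
    · rintro ⟨i, rfl⟩
      refine ⟨M.ι i M.a, fun h => M.hab (M.ι_eq_c.1 h), (key i _ M.hab).symm⟩
  rw [ptOrder, this, ← Set.image_univ, Set.ncard_image_of_injective]
  · simp [Set.ncard_univ]
  · intro i j hij
    by_contra hne
    have h1 : M.ι i M.a ∈ M.ι i '' ({M.b}ᶜ : Set X) := ⟨_, M.hab, rfl⟩
    have hij' : M.ι i '' ({M.b}ᶜ : Set X) = M.ι j '' {M.b}ᶜ := hij
    rw [hij'] at h1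
    obtain ⟨z, hz, h⟩ := h1
    exact hz (M.inj_ne (Ne.symm hne) h).1

theorem ptOrder_not_br {p : X} (hp : ¬ M.Br p) : ptOrder X p = 1 ∨ ptOrder X p = 2 := by
  have hne : ∃ x : X, x ≠ p := by
    by_cases h : M.a = p
    · exact ⟨M.b, fun h' => M.hab (h.trans h'.symm)⟩
    · exact ⟨_, h⟩
  have two : ∀ C D E, C ∈ setComponents X {p}ᶜ → D ∈ setComponents X {p}ᶜ →
      E ∈ setComponents X {p}ᶜ → C = D ∨ D = E ∨ C = E := by
    rintro _ _ _ ⟨x, hx, rfl⟩ ⟨y, hy, rfl⟩ ⟨z, hz, rfl⟩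
    obtain ⟨k1, h1⟩ := M.eventually_Yc' hx
    obtain ⟨k2, h2⟩ := M.eventually_Yc' hy
    obtain ⟨k3, h3⟩ := M.eventually_Yc' hz
    obtain ⟨w, q, hw, hq⟩ := M.cell_surj (k1 + k2 + k3) p
    have hbr : p ∈ Set.range (M.cell w) := ⟨_, hq.symm⟩
    have hbY : p ∉ M.Yc w := fun h => hp (M.Yc_inter w _ h hbr)
    have key : ∀ z, z ∈ M.Yc w → ∃ C ⊆ ({p}ᶜ : Set X), IsPreconnected C ∧ z ∈ C ∧
        (M.cell w M.a ∈ C ∨ M.cell w M.b ∈ C) := by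
      intro z hz
      obtain ⟨C, hC, hC1, hC2, hC3⟩ := M.Yc_conn w z hz
      refine ⟨C, ?_, hC1, hC2, hC3⟩
      rintro r hr rfl
      exact hbY (hC hr)
    have fin : ∀ {C D : Set X} {x y q : X}, C ⊆ {p}ᶜ → D ⊆ {p}ᶜ → IsPreconnected C →
        IsPreconnected D → x ∈ C → y ∈ D → q ∈ C → q ∈ D →
        connectedComponentIn {p}ᶜ x = connectedComponentIn {p}ᶜ y := by
      intro C D x y q hC hD hC1 hD1 hx hy hq1 hq2
      exact connectedComponentIn_eq ((hC1.union _ hq1 hq2 hD1).subset_connectedComponentIn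
        (Or.inl hx) (Set.union_subset hC hD) (Or.inr hy))
    obtain ⟨C, hC, hC1, hC2, hC3⟩ := key x (h1 w (by omega) hbr)
    obtain ⟨D, hD, hD1, hD2, hD3⟩ := key y (h2 w (by omega) hbr)
    obtain ⟨E, hE, hE1, hE2, hE3⟩ := key z (h3 w (by omega) hbr)
    have f1 := fun q => fin (q := q) hC hD hC1 hD1 hC2 hD2
    have f2 := fun q => fin (q := q) hD hE hD1 hE1 hD2 hE2
    have f3 := fun q => fin (q := q) hC hE hC1 hE1 hC2 hE2
    rcases hC3 with hC3 | hC3 <;> rcases hD3 with hD3 | hD3 <;> rcases hE3 with hE3 | hE3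
    · exact Or.inl (f1 _ hC3 hD3)
    · exact Or.inl (f1 _ hC3 hD3)
    · exact Or.inr (Or.inr (f3 _ hC3 hE3))
    · exact Or.inr (Or.inl (f2 _ hD3 hE3))
    · exact Or.inr (Or.inl (f2 _ hD3 hE3))
    · exact Or.inr (Or.inr (f3 _ hC3 hE3))
    · exact Or.inl (f1 _ hC3 hD3)
    · exact Or.inl (f1 _ hC3 hD3)
  obtain ⟨x, hx⟩ := hne
  have h1 : connectedComponentIn {p}ᶜ x ∈ setComponents X {p}ᶜ := ⟨x, hx, rfl⟩
  by_cases hall : ∀ D ∈ setComponents X {p}ᶜ, D = connectedComponentIn {p}ᶜ x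
  · left
    rw [ptOrder, Set.ncard_eq_one]
    exact ⟨_, Set.eq_singleton_iff_unique_mem.2 ⟨h1, hall⟩⟩
  · right
    push Not at hall
    obtain ⟨D, hD, hDx⟩ := hall
    rw [ptOrder, Set.ncard_eq_two]
    refine ⟨_, D, hDx.symm, ?_⟩
    ext E
    constructor
    · intro hE
      rcases two _ _ _ h1 hD hE with h | h | h
      · exact absurd h.symm hDx
      · right; exact h.symm
      · left; exact h.symm
    · rintro (rfl | rfl)
      · exact h1
      · exact hD

theorem _root_.ptOrder_homeo (h : X ≃ₜ X) (p : X) : ptOrder X (h p) = ptOrder X p := by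
  have key : ∀ (h : X ≃ₜ X) (p : X), setComponents X {h p}ᶜ =
      (fun C => h '' C) '' setComponents X {p}ᶜ := by
    intro h p
    have h0 : h '' {p}ᶜ = {h p}ᶜ := by
      rw [Set.image_compl_eq h.bijective, Set.image_singleton]
    ext C
    constructor
    · rintro ⟨x, hx, rfl⟩
      refine ⟨_, ⟨h.symm x, fun hx' => hx ?_, rfl⟩, ?_⟩
      · rw [← hx', Homeomorph.apply_symm_apply]; rfl
      · have hx' : h.symm x ∈ ({p}ᶜ : Set X) := fun hx' => hx (by
          rw [← hx', Homeomorph.apply_symm_apply]; rfl)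
        change h '' connectedComponentIn _ _ = _
        rw [h.image_connectedComponentIn hx', h0, Homeomorph.apply_symm_apply]
    · rintro ⟨_, ⟨x, hx, rfl⟩, rfl⟩
      refine ⟨h x, fun hx' => hx (h.injective hx'), ?_⟩
      change h '' connectedComponentIn _ _ = _
      rw [h.image_connectedComponentIn hx, h0]
  rw [ptOrder, key, Set.ncard_image_of_injective _ (Set.image_injective.2 h.injective)]
  rfl

end WModel


theorem homeo_mul_apply {X : Type} [TopologicalSpace X] (f g : X ≃ₜ X) (x : X) :
    (f * g) x = f (g x) := rfl

theorem homeo_one_apply {X : Type} [TopologicalSpace X] (x : X) :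
    (1 : X ≃ₜ X) x = x := rfl

theorem homeo_inv_apply_self {X : Type} [TopologicalSpace X] (f : X ≃ₜ X) (x : X) :
    f⁻¹ (f x) = x := f.symm_apply_apply x

theorem homeo_apply_inv_self {X : Type} [TopologicalSpace X] (f : X ≃ₜ X) (x : X) :
    f (f⁻¹ x) = x := f.apply_symm_apply x

theorem homeo_inv_eq {X : Type} [TopologicalSpace X] {f : X ≃ₜ X} {x y : X} (h : f x = y) :
    f⁻¹ y = x := by rw [← h, homeo_inv_apply_self]

theorem conj_mem_aux {Γ : Type*} [Group Γ] {H : Subgroup Γ} {x y z : Γ} (h : x * y = z * x)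
    (hx : x ∈ H) (hy : y ∈ H) : z ∈ H := by
  have : z = x * y * x⁻¹ := by rw [h]; group
  rw [this]
  exact H.mul_mem (H.mul_mem hx hy) (H.inv_mem hx)

namespace WModel

variable {N : ℕ} {X : Type} [TopologicalSpace X] (M : WModel N X)

theorem hext {f g : X ≃ₜ X} (h : ∀ i x, f (M.ι i x) = g (M.ι i x)) : f = g := by
  ext x
  obtain ⟨i, y, rfl⟩ := M.surj x
  exact h i y

variable [CompactSpace X] [T2Space X]

theorem exists_W (π : Equiv.Perm (Fin (N + 3))) (k : Fin (N + 3) → (X ≃ₜ X))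
    (hk : ∀ i, k i M.b = M.b) :
    ∃ h : X ≃ₜ X, ∀ i x, h (M.ι i x) = M.ι (π i) (k i x) := by
  obtain ⟨f, hf, hf2⟩ := M.glue_aux (fun i x => M.ι (π i) (k i x))
    (fun i => (M.cont _).comp (k i).continuous) (fun i j => by
      change M.ι _ _ = M.ι _ _
      rw [hk, hk, M.ιb, M.ιb])
  obtain ⟨g, hg, hg2⟩ := M.glue_aux (fun i x => M.ι (π.symm i) ((k (π.symm i)).symm x))
    (fun i => (M.cont _).comp (k _).symm.continuous) (fun i j => by
      have : ∀ i, (k i).symm M.b = M.b := fun i => homeo_inv_eq (hk i)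
      change M.ι _ _ = M.ι _ _
      rw [this, this, M.ιb, M.ιb])
  refine ⟨⟨⟨f, g, ?_, ?_⟩, hf, hg⟩, hf2⟩
  · intro x
    obtain ⟨i, y, rfl⟩ := M.surj x
    rw [hf2, hg2]
    simp
  · intro x
    obtain ⟨i, y, rfl⟩ := M.surj x
    rw [hg2, hf2]
    simp

/-- Permutation of the branches at `c`. -/
noncomputable def P (π : Equiv.Perm (Fin (N + 3))) : X ≃ₜ X :=
  (M.exists_W π (fun _ => 1) (fun _ => rfl)).choose

theorem P_apply (π i x) : M.P π (M.ι i x) = M.ι (π i) x :=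
  (M.exists_W π (fun _ => 1) (fun _ => rfl)).choose_spec i x

open Classical in
theorem exists_E (i : Fin (N + 3)) (k : X ≃ₜ X) (hk : k M.b = M.b) :
    ∃ h : X ≃ₜ X, (∀ x, h (M.ι i x) = M.ι i (k x)) ∧
      ∀ j, j ≠ i → ∀ x, h (M.ι j x) = M.ι j x := by
  obtain ⟨h, hh⟩ := M.exists_W 1 (fun j => if j = i then k else 1) (fun j => by
    split_ifs
    · exact hk
    · rfl)
  refine ⟨h, fun x => ?_, fun j hj x => ?_⟩
  · rw [hh, if_pos rfl]; rfl
  · rw [hh, if_neg hj]; rfl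

open Classical in
/-- The homeomorphism acting as `k` on the `i`-th branch. -/
noncomputable def E (i : Fin (N + 3)) (k : X ≃ₜ X) : X ≃ₜ X :=
  if hk : k M.b = M.b then (M.exists_E i k hk).choose else 1

theorem E_same (i) {k : X ≃ₜ X} (hk : k M.b = M.b) (x) : M.E i k (M.ι i x) = M.ι i (k x) := by
  rw [E, dif_pos hk]
  exact (M.exists_E i k hk).choose_spec.1 x

theorem E_ne {i} (k : X ≃ₜ X) {j} (hj : j ≠ i) (x) : M.E i k (M.ι j x) = M.ι j x := by
  rw [E]
  split_ifs with hk
  · exact (M.exists_E i k hk).choose_spec.2 j hj x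
  · rfl

theorem E_b {i} (k : X ≃ₜ X) (hi : i ≠ 1) : M.E i k M.b = M.b := by
  conv_lhs => rw [← M.endA]
  rw [M.E_ne k (Ne.symm hi), M.endA]

theorem E_a {i} (k : X ≃ₜ X) (hi : i ≠ 0) : M.E i k M.a = M.a := by
  conv_lhs => rw [← M.fixA]
  rw [M.E_ne k (Ne.symm hi), M.fixA]

theorem E1_b {k : X ≃ₜ X} (ha : k M.a = M.a) (hb : k M.b = M.b) : M.E 1 k M.b = M.b := by
  conv_lhs => rw [← M.endA]
  rw [M.E_same 1 hb, ha, M.endA]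

theorem E0_a {k : X ≃ₜ X} (ha : k M.a = M.a) (hb : k M.b = M.b) : M.E 0 k M.a = M.a := by
  conv_lhs => rw [← M.fixA]
  rw [M.E_same 0 hb, ha, M.fixA]

theorem E_mul (i) {k k' : X ≃ₜ X} (hk : k M.b = M.b) (hk' : k' M.b = M.b) :
    M.E i (k * k') = M.E i k * M.E i k' := by
  apply M.hext
  intro j x
  have h3 : (k * k') M.b = M.b := by rw [homeo_mul_apply, hk', hk]
  rw [homeo_mul_apply]
  by_cases hj : j = i
  · subst hj
    rw [M.E_same _ h3, M.E_same _ hk', M.E_same _ hk, homeo_mul_apply]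
  · rw [M.E_ne _ hj, M.E_ne _ hj, M.E_ne _ hj]

theorem E_one (i) : M.E i 1 = 1 := by
  apply M.hext
  intro j x
  by_cases hj : j = i
  · subst hj
    rw [M.E_same _ rfl]; rfl
  · rw [M.E_ne _ hj]; rfl

theorem E_inv (i) {k : X ≃ₜ X} (hk : k M.b = M.b) : M.E i k⁻¹ = (M.E i k)⁻¹ := by
  rw [eq_inv_iff_mul_eq_one, ← M.E_mul i (homeo_inv_eq hk) hk, inv_mul_cancel, E_one]

/-- The flip. -/
noncomputable def τ : X ≃ₜ X := M.P (Equiv.swap 0 1)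

theorem τ0 (x) : M.τ (M.ι 0 x) = M.ι 1 x := by
  rw [τ, P_apply, Equiv.swap_apply_left]

theorem τ1 (x) : M.τ (M.ι 1 x) = M.ι 0 x := by
  rw [τ, P_apply, Equiv.swap_apply_right]

theorem τj {j} (h0 : j ≠ 0) (h1 : j ≠ 1) (x) : M.τ (M.ι j x) = M.ι j x := by
  rw [τ, P_apply, Equiv.swap_apply_of_ne_of_ne h0 h1]

theorem τa : M.τ M.a = M.b := by rw [← M.fixA, τ0, M.endA]
theorem τb : M.τ M.b = M.a := by rw [← M.endA, τ1, M.fixA]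

theorem ττ (x) : M.τ (M.τ x) = x := by
  obtain ⟨i, y, rfl⟩ := M.surj x
  rw [τ, P_apply, P_apply, Equiv.swap_apply_self]

theorem exists_s (M : WModel N X) : ∃ s : X ≃ₜ X, (∀ x, s (M.ι 1 x) = M.ι 0 (M.ι 0 x)) ∧
    (∀ x, s (M.ι 0 (M.ι 0 x)) = M.ι 1 x) ∧ (∀ x, s (M.ι 0 (M.ι 1 x)) = M.ι 0 (M.ι 1 (M.τ x))) ∧
    (∀ j, j ≠ 0 → j ≠ 1 → ∀ x, s (M.ι j x) = M.ι 0 (M.ι j x)) ∧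
    (∀ j, j ≠ 0 → j ≠ 1 → ∀ x, s (M.ι 0 (M.ι j x)) = M.ι j x) := by
  have h10 : (1 : Fin (N + 3)) ≠ 0 := by simp
  obtain ⟨f0, hf0, hf0'⟩ := M.glue_aux (fun j x => if j = 0 then M.ι 1 x else
    if j = 1 then M.ι 0 (M.ι 1 (M.τ x)) else M.ι j x) (by
      intro j
      have := M.cont
      have := M.τ.continuous
      split_ifs <;> fun_prop) (by
      have : ∀ j : Fin (N + 3), (if j = 0 then M.ι 1 M.b else
        if j = 1 then M.ι 0 (M.ι 1 (M.τ M.b)) else M.ι j M.b) = M.c := by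
        intro j
        split_ifs
        · exact M.ιb _
        · rw [τb, M.endA, M.ιb]
        · exact M.ιb _
      intro i j
      exact (this i).trans (this j).symm)
  obtain ⟨f, hf, hf'⟩ := M.glue_aux (fun j x => if j = 0 then f0 x else
    if j = 1 then M.ι 0 (M.ι 0 x) else M.ι 0 (M.ι j x)) (by
      intro j
      have := M.cont
      split_ifs <;> fun_prop) (by
      have : ∀ j : Fin (N + 3), (if j = 0 then f0 M.b else
        if j = 1 then M.ι 0 (M.ι 0 M.b) else M.ι 0 (M.ι j M.b)) = M.ι 0 M.c := by
        intro j
        split_ifs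
        · rw [← M.endA, hf0', if_neg h10, if_pos rfl, τa, M.ιb]
        · rw [M.ιb]
        · rw [M.ιb]
      intro i j
      exact (this i).trans (this j).symm)
  have s1 : ∀ x, f (M.ι 1 x) = M.ι 0 (M.ι 0 x) := fun x => by
    rw [hf', if_neg h10, if_pos rfl]
  have s2 : ∀ x, f (M.ι 0 (M.ι 0 x)) = M.ι 1 x := fun x => by
    rw [hf', if_pos rfl, hf0', if_pos rfl]
  have s3 : ∀ x, f (M.ι 0 (M.ι 1 x)) = M.ι 0 (M.ι 1 (M.τ x)) := fun x => by
    rw [hf', if_pos rfl, hf0', if_neg h10, if_pos rfl]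
  have s4 : ∀ j, j ≠ 0 → j ≠ 1 → ∀ x, f (M.ι j x) = M.ι 0 (M.ι j x) := fun j h0 h1 x => by
    rw [hf', if_neg h0, if_neg h1]
  have s5 : ∀ j, j ≠ 0 → j ≠ 1 → ∀ x, f (M.ι 0 (M.ι j x)) = M.ι j x := fun j h0 h1 x => by
    rw [hf', if_pos rfl, hf0', if_neg h0, if_neg h1]
  have hinv : Function.Involutive f := by
    intro x
    obtain ⟨i, x, rfl⟩ := M.surj x
    by_cases h0 : i = 0
    · subst h0
      obtain ⟨j, x, rfl⟩ := M.surj x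
      by_cases h0 : j = 0
      · subst h0; rw [s2, s1]
      by_cases h1 : j = 1
      · subst h1; rw [s3, s3, ττ]
      rw [s5 j h0 h1, s4 j h0 h1]
    by_cases h1 : i = 1
    · subst h1; rw [s1, s2]
    rw [s4 i h0 h1, s5 i h0 h1]
  exact ⟨⟨hinv.toPerm, hf, hf⟩, s1, s2, s3, s4, s5⟩

/-- Translation along the arc from `a` to `b`. -/
noncomputable def t : X ≃ₜ X := M.τ * M.exists_s.choose

theorem t1 (x) : M.t (M.ι 1 x) = M.ι 1 (M.ι 0 x) := by
  rw [t, homeo_mul_apply, M.exists_s.choose_spec.1, τ0]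

theorem t00 (x) : M.t (M.ι 0 (M.ι 0 x)) = M.ι 0 x := by
  rw [t, homeo_mul_apply, M.exists_s.choose_spec.2.1, τ1]

theorem t01 (x) : M.t (M.ι 0 (M.ι 1 x)) = M.ι 1 (M.ι 1 (M.τ x)) := by
  rw [t, homeo_mul_apply, M.exists_s.choose_spec.2.2.1, τ0]

theorem tj {j} (h0 : j ≠ 0) (h1 : j ≠ 1) (x) : M.t (M.ι j x) = M.ι 1 (M.ι j x) := by
  rw [t, homeo_mul_apply, M.exists_s.choose_spec.2.2.2.1 j h0 h1, τ0]

theorem t0j {j} (h0 : j ≠ 0) (h1 : j ≠ 1) (x) : M.t (M.ι 0 (M.ι j x)) = M.ι j x := by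
  rw [t, homeo_mul_apply, M.exists_s.choose_spec.2.2.2.2 j h0 h1, τj _ h0 h1]

theorem ta : M.t M.a = M.a := by
  conv_lhs => rw [← M.fixA, ← M.fixA]
  rw [t00, M.fixA]

theorem tb : M.t M.b = M.b := by
  conv_lhs => rw [← M.endA]
  rw [t1, M.fixA, M.endA]

theorem tc : M.t M.c = M.ι 1 M.c := by
  conv_lhs => rw [← M.ιb 1]
  rw [t1, M.ιb]

theorem tp0 : M.t (M.ι 0 M.c) = M.c := by
  conv_lhs => rw [← M.ιb 0]
  rw [t00, M.ιb]

theorem P_b {π : Equiv.Perm (Fin (N + 3))} (h : π 1 = 1) : M.P π M.b = M.b := by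
  conv_lhs => rw [← M.endA]
  rw [P_apply, h, M.endA]

theorem P_a {π : Equiv.Perm (Fin (N + 3))} (h : π 0 = 0) : M.P π M.a = M.a := by
  conv_lhs => rw [← M.fixA]
  rw [P_apply, h, M.fixA]

theorem P_c (π : Equiv.Perm (Fin (N + 3))) : M.P π M.c = M.c := by
  conv_lhs => rw [← M.ιb 0]
  rw [P_apply, M.ιb]

theorem conjP (π i) {k : X ≃ₜ X} (hk : k M.b = M.b) :
    M.P π * M.E i k = M.E (π i) k * M.P π := by
  apply M.hext
  intro j x
  rw [homeo_mul_apply, homeo_mul_apply, P_apply]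
  by_cases hj : j = i
  · subst hj
    rw [M.E_same _ hk, M.E_same _ hk, P_apply]
  · rw [M.E_ne _ hj, M.E_ne _ (fun h => hj (π.injective h)), P_apply]

/-- Extensionality adapted to `t`. -/
theorem hext2 {f g : X ≃ₜ X} (h1 : ∀ x, f (M.ι 1 x) = g (M.ι 1 x))
    (h00 : ∀ x, f (M.ι 0 (M.ι 0 x)) = g (M.ι 0 (M.ι 0 x)))
    (h01 : ∀ x, f (M.ι 0 (M.ι 1 x)) = g (M.ι 0 (M.ι 1 x)))
    (hj : ∀ j, j ≠ 0 → j ≠ 1 → ∀ x, f (M.ι j x) = g (M.ι j x))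
    (h0j : ∀ j, j ≠ 0 → j ≠ 1 → ∀ x, f (M.ι 0 (M.ι j x)) = g (M.ι 0 (M.ι j x))) : f = g := by
  apply M.hext
  intro i x
  by_cases hi0 : i = 0
  · subst hi0
    obtain ⟨j, x, rfl⟩ := M.surj x
    by_cases hj0 : j = 0
    · subst hj0; exact h00 x
    by_cases hj1 : j = 1
    · subst hj1; exact h01 x
    exact h0j j hj0 hj1 x
  by_cases hi1 : i = 1
  · subst hi1; exact h1 x
  exact hj i hi0 hi1 x

theorem conjt1 {k : X ≃ₜ X} (hk : k M.b = M.b) :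
    M.t * M.E 1 k = M.E 1 (M.E 0 k) * M.t := by
  have h10 : (1 : Fin (N + 3)) ≠ 0 := by simp
  have hE : M.E 0 k M.b = M.b := M.E_b k h10.symm
  apply M.hext2 <;> intros <;> simp only [homeo_mul_apply]
  · rw [M.E_same _ hk, t1, t1, M.E_same _ hE, M.E_same _ hk]
  · rw [M.E_ne _ h10.symm, t00, M.E_ne _ h10.symm]
  · rw [M.E_ne _ h10.symm, t01, M.E_same _ hE, M.E_ne _ h10]
  · rename_i j h0 h1 x
    rw [M.E_ne _ h1, M.tj h0 h1, M.E_same _ hE, M.E_ne _ h0]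
  · rename_i j h0 h1 x
    rw [M.E_ne _ h10.symm, M.t0j h0 h1, M.E_ne _ h1]

theorem conjtj {k : X ≃ₜ X} (hk : k M.b = M.b) {i} (hi0 : i ≠ 0) (hi1 : i ≠ 1) :
    M.t * M.E i k = M.E 1 (M.E i k) * M.t := by
  have h10 : (1 : Fin (N + 3)) ≠ 0 := by simp
  have hE : M.E i k M.b = M.b := M.E_b k hi1
  apply M.hext2 <;> intros <;> simp only [homeo_mul_apply]
  · rw [M.E_ne _ hi1.symm, t1, M.E_same _ hE, M.E_ne _ hi0.symm]
  · rw [M.E_ne _ hi0.symm, t00, M.E_ne _ h10.symm]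
  · rw [M.E_ne _ hi0.symm, t01, M.E_same _ hE, M.E_ne _ hi1.symm]
  · rename_i j h0 h1 x
    by_cases hj : j = i
    · subst hj
      rw [M.E_same _ hk, M.tj h0 h1, M.tj h0 h1, M.E_same _ hE, M.E_same _ hk]
    · rw [M.E_ne _ hj, M.tj h0 h1, M.E_same _ hE, M.E_ne _ hj]
  · rename_i j h0 h1 x
    rw [M.E_ne _ hi0.symm, M.t0j h0 h1, M.E_ne _ h1]

theorem conjt01 {k : X ≃ₜ X} (ha : k M.a = M.a) (hk : k M.b = M.b) :
    M.t * M.E 0 (M.E 1 k) = M.E 1 (M.E 1 (M.τ * k * M.τ)) * M.t := by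
  have h10 : (1 : Fin (N + 3)) ≠ 0 := by simp
  have hE : M.E 1 k M.b = M.b := M.E1_b ha hk
  have ha' : (M.τ * k * M.τ) M.a = M.a := by
    simp only [homeo_mul_apply]; rw [τa, hk, τb]
  have hb' : (M.τ * k * M.τ) M.b = M.b := by
    simp only [homeo_mul_apply]; rw [τb, ha, τa]
  have hE' : M.E 1 (M.τ * k * M.τ) M.b = M.b := M.E1_b ha' hb'
  apply M.hext2 <;> intros <;> simp only [homeo_mul_apply]
  · rw [M.E_ne _ h10, t1, M.E_same _ hE', M.E_ne _ h10.symm]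
  · rw [M.E_same _ hE, M.E_ne _ h10.symm, t00, M.E_ne _ h10.symm]
  · rw [M.E_same _ hE, M.E_same _ hk, t01, t01, M.E_same _ hE', M.E_same _ hb']
    simp only [homeo_mul_apply]
    rw [ττ]
  · rename_i j h0 h1 x
    rw [M.E_ne _ h0, M.tj h0 h1, M.E_same _ hE', M.E_ne _ h1]
  · rename_i j h0 h1 x
    rw [M.E_same _ hE, M.E_ne _ h1, M.t0j h0 h1, M.E_ne _ h1]

/-- The generators. -/
def gens : Set (X ≃ₜ X) :=
  ((Set.range M.P ∪ {M.t}) ∪ (M.E 1 '' (Set.range M.P ∪ {M.t}))) ∪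
    (M.E 1 '' (M.E 1 '' (Set.range M.P ∪ {M.t})))

theorem gens_finite : M.gens.Finite := by
  have : (Set.range M.P ∪ {M.t}).Finite := (Set.finite_range _).union (Set.finite_singleton _)
  exact (this.union (this.image _)).union ((this.image _).image _)

/-- The group. -/
def G : Subgroup (X ≃ₜ X) := Subgroup.closure M.gens

theorem G_fg : M.G.FG := (Subgroup.fg_iff _).2 ⟨M.gens, rfl, M.gens_finite⟩

theorem P_mem_G (π) : M.P π ∈ M.G := Subgroup.subset_closure (Or.inl (Or.inl (Or.inl ⟨π, rfl⟩)))
theorem t_mem_G : M.t ∈ M.G := Subgroup.subset_closure (Or.inl (Or.inl (Or.inr rfl)))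
theorem EP_mem_G (π) : M.E 1 (M.P π) ∈ M.G :=
  Subgroup.subset_closure (Or.inl (Or.inr ⟨_, Or.inl ⟨π, rfl⟩, rfl⟩))
theorem Et_mem_G : M.E 1 M.t ∈ M.G :=
  Subgroup.subset_closure (Or.inl (Or.inr ⟨_, Or.inr rfl, rfl⟩))
theorem EEP_mem_G (π) : M.E 1 (M.E 1 (M.P π)) ∈ M.G :=
  Subgroup.subset_closure (Or.inr ⟨_, ⟨_, Or.inl ⟨π, rfl⟩, rfl⟩, rfl⟩)
theorem EEt_mem_G : M.E 1 (M.E 1 M.t) ∈ M.G :=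
  Subgroup.subset_closure (Or.inr ⟨_, ⟨_, Or.inr rfl, rfl⟩, rfl⟩)

/-- Lifting a group of homeomorphisms to the branch `1`. -/
def lift1 (H : Subgroup (X ≃ₜ X)) : Subgroup (X ≃ₜ X) where
  carrier := {k | k M.b = M.b ∧ M.E 1 k ∈ H}
  mul_mem' := by
    rintro k k' ⟨h1, h2⟩ ⟨h3, h4⟩
    refine ⟨by rw [homeo_mul_apply, h3, h1], ?_⟩
    rw [M.E_mul 1 h1 h3]
    exact H.mul_mem h2 h4
  one_mem' := ⟨rfl, by rw [E_one]; exact H.one_mem⟩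
  inv_mem' := by
    rintro k ⟨h1, h2⟩
    refine ⟨homeo_inv_eq h1, ?_⟩
    rw [M.E_inv 1 h1]
    exact H.inv_mem h2

/-- Elements whose copy on the branch `1` belongs to `G`. -/
def N1 : Subgroup (X ≃ₜ X) := M.lift1 M.G

/-- Elements fixing `a` and `b` whose copy on the cell `11` belongs to `G`. -/
def N2 : Subgroup (X ≃ₜ X) where
  carrier := {k | k M.a = M.a ∧ k ∈ M.lift1 M.N1}
  mul_mem' := by
    rintro k k' ⟨h1, h2⟩ ⟨h3, h4⟩
    exact ⟨by rw [homeo_mul_apply, h3, h1], Subgroup.mul_mem _ h2 h4⟩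
  one_mem' := ⟨rfl, Subgroup.one_mem _⟩
  inv_mem' := by
    rintro k ⟨h1, h2⟩
    exact ⟨homeo_inv_eq h1, Subgroup.inv_mem _ h2⟩

variable {M} in
theorem N1.b {k : X ≃ₜ X} (h : k ∈ M.N1) : k M.b = M.b := h.1

variable {M} in
theorem N2.b {k : X ≃ₜ X} (h : k ∈ M.N2) : k M.b = M.b := h.2.1

variable {M} in
theorem N2.a {k : X ≃ₜ X} (h : k ∈ M.N2) : k M.a = M.a := h.1

theorem t_mem_N1 : M.t ∈ M.N1 := ⟨M.tb, M.Et_mem_G⟩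

theorem P_mem_N1 {π : Equiv.Perm (Fin (N + 3))} (h : π 1 = 1) : M.P π ∈ M.N1 :=
  ⟨M.P_b h, M.EP_mem_G π⟩

theorem t_mem_N2 : M.t ∈ M.N2 :=
  ⟨M.ta, M.tb, M.E1_b M.ta M.tb, M.EEt_mem_G⟩

theorem P_mem_N2 {π : Equiv.Perm (Fin (N + 3))} (h0 : π 0 = 0) (h : π 1 = 1) : M.P π ∈ M.N2 :=
  ⟨M.P_a h0, M.P_b h, M.E1_b (M.P_a h0) (M.P_b h), M.EEP_mem_G π⟩

theorem E_mem_G {k : X ≃ₜ X} (h : k ∈ M.N1) (j) : M.E j k ∈ M.G := by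
  have := M.conjP (Equiv.swap 1 j) 1 h.1
  rw [Equiv.swap_apply_left] at this
  exact conj_mem_aux this (M.P_mem_G _) h.2

theorem E_mem_N1 {k : X ≃ₜ X} (h : k ∈ M.N1) {j} (hj : j ≠ 1) : M.E j k ∈ M.N1 := by
  refine ⟨M.E_b k hj, ?_⟩
  by_cases h0 : j = 0
  · subst h0
    exact conj_mem_aux (M.conjt1 h.1) M.t_mem_G h.2
  · exact conj_mem_aux (M.conjtj h.1 h0 hj) M.t_mem_G (M.E_mem_G h j)

theorem E1_mem_N1 {k : X ≃ₜ X} (h : k ∈ M.N2) : M.E 1 k ∈ M.N1 := h.2.2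

theorem Ej_mem_N2 {k : X ≃ₜ X} (h : k ∈ M.N1) {j} (h0 : j ≠ 0) (h1 : j ≠ 1) :
    M.E j k ∈ M.N2 :=
  ⟨M.E_a k h0, M.E_b k h1, conj_mem_aux (M.conjtj h.1 h0 h1) M.t_mem_N1 (M.E_mem_N1 h h1)⟩

theorem flip_mem_N2 {k : X ≃ₜ X} (h : k ∈ M.N2) : M.τ * k * M.τ ∈ M.N2 := by
  have ha' : (M.τ * k * M.τ) M.a = M.a := by
    simp only [homeo_mul_apply]; rw [τa, N2.b h, τb]
  have hb' : (M.τ * k * M.τ) M.b = M.b := by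
    simp only [homeo_mul_apply]; rw [τb, N2.a h, τa]
  refine ⟨ha', hb', M.E1_b ha' hb', ?_⟩
  exact conj_mem_aux (M.conjt01 (N2.a h) (N2.b h)) M.t_mem_G (M.E_mem_G (M.E1_mem_N1 h) 0)

theorem E1_mem_N2 {k : X ≃ₜ X} (h : k ∈ M.N2) : M.E 1 k ∈ M.N2 := by
  have key : ∀ k ∈ M.N2, M.E 1 (M.τ * k * M.τ) ∈ M.N2 := by
    intro k h
    have h' := M.flip_mem_N2 h
    refine ⟨M.E_a _ (by simp), M.E1_b (N2.a h') (N2.b h'), ?_⟩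
    exact conj_mem_aux (M.conjt01 (N2.a h) (N2.b h)) M.t_mem_N1
      (M.E_mem_N1 (M.E1_mem_N1 h) (by simp))
  have := key _ (M.flip_mem_N2 h)
  convert this using 2
  ext x
  simp only [homeo_mul_apply]
  rw [ττ, ττ]

theorem E0_mem_N2 {k : X ≃ₜ X} (h : k ∈ M.N2) : M.E 0 k ∈ M.N2 := by
  have h1 := M.flip_mem_N2 (M.E1_mem_N2 h)
  have h2 := M.conjP (Equiv.swap 0 1) 1 (N2.b h)
  rw [Equiv.swap_apply_right] at h2
  have h3 : M.τ * M.E 1 k * M.τ = M.E 0 k := by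
    rw [τ, h2]
    ext x
    simp only [homeo_mul_apply]
    change M.E 0 k (M.τ (M.τ x)) = _
    rw [ττ]
  rwa [h3] at h1

end WModel


namespace WModel

variable {N : ℕ} {X : Type} [TopologicalSpace X] (M : WModel N X)

theorem Br_fin {x : X} (h : M.Br x) : ∃ w, x = M.cell w M.c := by
  induction h with
  | c => exact ⟨[], rfl⟩
  | step i _ ih =>
    obtain ⟨w, rfl⟩ := ih
    exact ⟨i :: w, rfl⟩

variable [CompactSpace X] [T2Space X]

theorem P_cell (π) (w : List (Fin (N + 3))) :
    ∃ w' : List (Fin (N + 3)), w'.length = w.length ∧ M.P π (M.cell w M.c) = M.cell w' M.c := by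
  cases w with
  | nil => exact ⟨[], rfl, M.P_c π⟩
  | cons i w => exact ⟨π i :: w, rfl, by rw [M.cell_cons, M.P_apply, M.cell_cons]⟩

theorem trans1 (m : ℕ) : ∀ w : List (Fin (N + 3)), w.length = m →
    ∃ g ∈ M.N1, g M.c = M.cell w M.c := by
  induction m with
  | zero =>
    intro w hw
    rw [List.length_eq_zero_iff] at hw
    subst hw
    exact ⟨1, M.N1.one_mem, rfl⟩
  | succ m ih =>
    have key : ∀ (j : Fin (N + 3)) (w : List (Fin (N + 3))), j ≠ 1 → w.length = m →
        ∃ g ∈ M.N1, g M.c = M.cell (j :: w) M.c := by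
      intro j w hj hw
      obtain ⟨g, hg, hgc⟩ := ih w hw
      have hsw : (Equiv.swap 0 j) (1 : Fin (N + 3)) = 1 :=
        Equiv.swap_apply_of_ne_of_ne (by simp) hj.symm
      refine ⟨M.E j g * (M.P (Equiv.swap 0 j) * M.t⁻¹), M.N1.mul_mem (M.E_mem_N1 hg hj)
        (M.N1.mul_mem (M.P_mem_N1 hsw) (M.N1.inv_mem M.t_mem_N1)), ?_⟩
      simp only [homeo_mul_apply]
      rw [homeo_inv_eq M.tp0, M.P_apply, Equiv.swap_apply_left, M.E_same j hg.1, hgc]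
      rfl
    intro w hw
    cases w with
    | nil => simp at hw
    | cons j w =>
      have hw' : w.length = m := by simpa using hw
      by_cases hj : j = 1
      swap
      · exact key j w hj hw'
      subst hj
      cases w with
      | nil => exact ⟨M.t, M.t_mem_N1, M.tc⟩
      | cons i w =>
        by_cases h0 : i = 0
        · subst h0
          obtain ⟨g, hg, hgc⟩ := ih (1 :: w) hw'
          refine ⟨M.t * g, M.N1.mul_mem M.t_mem_N1 hg, ?_⟩
          rw [homeo_mul_apply, hgc, M.cell_cons, M.t1]
          rfl
        by_cases h1 : i = 1
        · subst h1
          obtain ⟨w', hw1, hw2⟩ := M.P_cell (Equiv.swap 0 1) w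
          obtain ⟨g, hg, hgc⟩ := key 0 (1 :: w') (by simp) (by simpa [hw1] using hw')
          refine ⟨M.t * g, M.N1.mul_mem M.t_mem_N1 hg, ?_⟩
          rw [homeo_mul_apply, hgc, M.cell_cons, M.cell_cons, M.t01, ← hw2]
          change M.ι 1 (M.ι 1 (M.τ (M.τ _))) = _
          rw [M.ττ]
          rfl
        · obtain ⟨g, hg, hgc⟩ := ih (i :: w) hw'
          refine ⟨M.t * g, M.N1.mul_mem M.t_mem_N1 hg, ?_⟩
          rw [homeo_mul_apply, hgc, M.cell_cons, M.tj h0 h1]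
          rfl

theorem trans1' {q : X} (hq : M.Br q) : ∃ g ∈ M.N1, g M.c = q := by
  obtain ⟨w, rfl⟩ := M.Br_fin hq
  exact M.trans1 _ w rfl

theorem trans0 {q : X} (hq : M.Br q) : ∃ g ∈ M.G, g M.c = q := by
  cases hq with
  | c => exact ⟨1, M.G.one_mem, rfl⟩
  | @step j q hq =>
    obtain ⟨g, hg, hgc⟩ := M.trans1' hq
    refine ⟨M.E j g * (M.P (Equiv.swap 1 j) * M.t), M.G.mul_mem (M.E_mem_G hg j)
      (M.G.mul_mem (M.P_mem_G _) M.t_mem_G), ?_⟩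
    simp only [homeo_mul_apply]
    rw [M.tc, M.P_apply, Equiv.swap_apply_left, M.E_same j hg.1, hgc]

theorem proj2 {q : X} (hq : M.Br q) : ∃ g ∈ M.N2, g q = M.c ∨
    ∃ j x, j ≠ 0 ∧ j ≠ 1 ∧ g q = M.ι j x := by
  induction hq with
  | c => exact ⟨1, M.N2.one_mem, Or.inl rfl⟩
  | @step j q hq ih =>
    by_cases h0 : j = 0
    · subst h0
      obtain ⟨g, hg, h⟩ := ih
      refine ⟨M.t * M.E 0 g, M.N2.mul_mem M.t_mem_N2 (M.E0_mem_N2 hg), ?_⟩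
      rw [homeo_mul_apply, M.E_same 0 (N2.b hg)]
      rcases h with h | ⟨j, x, h0, h1, h⟩
      · left; rw [h, M.tp0]
      · right; exact ⟨j, x, h0, h1, by rw [h, M.t0j h0 h1]⟩
    by_cases h1 : j = 1
    · subst h1
      obtain ⟨g, hg, h⟩ := ih
      refine ⟨M.t⁻¹ * M.E 1 g, M.N2.mul_mem (M.N2.inv_mem M.t_mem_N2) (M.E1_mem_N2 hg), ?_⟩
      rw [homeo_mul_apply, M.E_same 1 (N2.b hg)]
      rcases h with h | ⟨j, x, h0, h1, h⟩
      · left; rw [h]; exact homeo_inv_eq M.tc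
      · right; exact ⟨j, x, h0, h1, by rw [h]; exact homeo_inv_eq (M.tj h0 h1 x)⟩
    · exact ⟨1, M.N2.one_mem, Or.inr ⟨j, q, h0, h1, rfl⟩⟩

theorem ptOrder_br {p : X} (hp : M.Br p) : ptOrder X p = N + 3 := by
  obtain ⟨g, _, rfl⟩ := M.trans0 hp
  rw [ptOrder_homeo, M.ptOrder_c]

theorem br_iff {p : X} : M.Br p ↔ ptOrder X p = N + 3 := by
  refine ⟨M.ptOrder_br, fun h => ?_⟩
  by_contra hp
  rcases M.ptOrder_not_br hp with h' | h' <;> omega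

theorem br_homeo (h : X ≃ₜ X) {p : X} (hp : M.Br p) : M.Br (h p) := by
  rw [br_iff, ptOrder_homeo, ← br_iff]
  exact hp

theorem trans2 (h : X ≃ₜ X) (ha : h M.a = M.a) (hb : h M.b = M.b) :
    ∃ g ∈ M.N2, g M.c = h M.c := by
  obtain ⟨g, hg, hg2⟩ := M.proj2 (M.br_homeo h .c)
  refine ⟨g⁻¹, M.N2.inv_mem hg, ?_⟩
  suffices h2 : g (h M.c) = M.c from homeo_inv_eq h2
  rcases hg2 with h1 | ⟨j, x, h0, h1, h2⟩
  · exact h1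
  have hS : IsPreconnected (Set.range (M.ι 0) ∪ Set.range (M.ι 1)) :=
    (M.preconn_ι 0).union M.c (M.c_mem_range 0) (M.c_mem_range 1) (M.preconn_ι 1)
  have hk : ∀ x, (g * h)⁻¹ ((g * h) x) = x := homeo_inv_apply_self _
  have hka : (g * h) M.a = M.a := by rw [homeo_mul_apply, ha, N2.a hg]
  have hkb : (g * h) M.b = M.b := by rw [homeo_mul_apply, hb, N2.b hg]
  have hS' := hS.image ⇑((g * h)⁻¹ : X ≃ₜ X) ((g * h)⁻¹).continuous.continuousOn
  have := M.sep [] hS' (i := 0) (j := 1) (x := M.a) (y := M.a) (by simp)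
    ⟨M.a, Or.inl ⟨_, M.fixA⟩, by rw [homeo_inv_eq hka]; exact M.fixA.symm⟩
    ⟨M.b, Or.inr ⟨_, M.endA⟩, by rw [homeo_inv_eq hkb]; exact M.endA.symm⟩
  obtain ⟨z, hz, hzc⟩ := this
  have hz2 : z = g (h M.c) := by
    rw [M.cell_nil] at hzc
    rw [← hzc]
    exact (homeo_apply_inv_self (g * h) z).symm
  rw [← hz2]
  rw [← hz2] at h2
  rcases hz with ⟨y, hy⟩ | ⟨y, hy⟩
  · rw [h2]; exact M.eq_c h0 (h2.symm.trans hy.symm)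
  · rw [h2]; exact M.eq_c h1 (h2.symm.trans hy.symm)

/-- Sets behaving like circles do not exist. -/
theorem no_circ (S : Set X) (hS : IsPreconnected S) (hS' : ∀ p, IsPreconnected (S \ {p}))
    (hinf : S.Infinite) (M : WModel N X) : False := by
  let Q : Set X → Prop := fun S => IsPreconnected S ∧ (∀ p, IsPreconnected (S \ {p})) ∧ S.Infinite
  have himg : ∀ (S : Set X) (h : X ≃ₜ X), Q S → Q (h '' S) := by
    rintro S h ⟨h1, h2, h3⟩
    refine ⟨h1.image _ h.continuous.continuousOn, fun p => ?_,
      h3.image h.injective.injOn⟩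
    have : h '' S \ {p} = h '' (S \ {h.symm p}) := by
      rw [Set.image_diff h.injective, Set.image_singleton, Homeomorph.apply_symm_apply]
    rw [this]
    exact (h2 _).image _ h.continuous.continuousOn
  have htriv : ∀ (S : Set X) (p : X), S.Infinite →
      ∃ y z, y ∈ S \ {p} ∧ z ∈ S \ {p} ∧ y ≠ z := by
    intro S p hS
    obtain ⟨y, hy, z, hz, hyz⟩ := (hS.diff (Set.finite_singleton p)).nontrivial
    exact ⟨y, z, hy, hz, hyz⟩
  have hbr : ∀ (S : Set X) (p : X), Q S → ∃ q ∈ S \ {p}, M.Br q := by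
    rintro S p ⟨h1, h2, h3⟩
    obtain ⟨y, z, hy, hz, hyz⟩ := htriv S p h3
    exact M.exists_br (h2 p) hy hz hyz
  have step1 : ∀ S, Q S → ∃ S, Q S ∧ M.c ∈ S := by
    intro S hS
    obtain ⟨q, hq, hqb⟩ := hbr S M.c hS
    obtain ⟨g, _, rfl⟩ := M.trans0 hqb
    refine ⟨_, himg S g.symm hS, ?_⟩
    exact ⟨_, hq.1, g.symm_apply_apply _⟩
  have step2 : ∀ S, Q S → M.c ∈ S → ∃ S, Q S ∧ M.b ∈ S := by
    intro S hS hc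
    obtain ⟨y, z, hy, hz, hyz⟩ := htriv S M.c hS.2.2
    obtain ⟨i, y, rfl⟩ := M.surj y
    have hsub : S ⊆ Set.range (M.ι i) := by
      intro x hx
      by_cases hxc : x = M.c
      · rw [hxc]; exact M.c_mem_range i
      obtain ⟨j, x, rfl⟩ := M.surj x
      by_cases hij : i = j
      · subst hij; exact ⟨x, rfl⟩
      exact absurd rfl (M.sep [] (hS.2.1 M.c) hij hy ⟨hx, hxc⟩).2
    have hpre : ∀ T : Set X, T ⊆ S → IsPreconnected T → IsPreconnected (M.ι i ⁻¹' T) := by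
      intro T hT hTc
      rw [← (M.isClosedEmb i).isInducing.isPreconnected_image, Set.image_preimage_eq_of_subset]
      · exact hTc
      · exact hT.trans hsub
    refine ⟨M.ι i ⁻¹' S, ⟨hpre S subset_rfl hS.1, fun p => ?_, ?_⟩, ?_⟩
    · have : M.ι i ⁻¹' S \ {p} = M.ι i ⁻¹' (S \ {M.ι i p}) := by
        ext x
        simp only [Set.mem_diff, Set.mem_preimage, Set.mem_singleton_iff]
        constructor
        · rintro ⟨h1, h2⟩
          exact ⟨h1, fun h => h2 (M.inj h)⟩
        · rintro ⟨h1, h2⟩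
          exact ⟨h1, fun h => h2 (by rw [h])⟩
      rw [this]
      exact hpre _ Set.diff_subset (hS.2.1 _)
    · exact hS.2.2.preimage hsub
    · change M.ι i M.b ∈ S
      rw [M.ιb]; exact hc
  obtain ⟨S, hS, hc⟩ := step1 S ⟨hS, hS', hinf⟩
  obtain ⟨S, hS, hb⟩ := step2 S hS hc
  obtain ⟨q, hq, hqb⟩ := hbr S M.b hS
  obtain ⟨g, hg, rfl⟩ := M.trans1' hqb
  have h3 := himg S (g * M.t)⁻¹ hS
  have hgb : (g * M.t) M.b = M.b := by rw [homeo_mul_apply, M.tb, N1.b hg]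
  have hb' : M.ι 1 M.a ∈ ⇑((g * M.t)⁻¹ : X ≃ₜ X) '' S \ {M.c} := by
    refine ⟨⟨M.b, hb, ?_⟩, ?_⟩
    · rw [M.endA]; exact homeo_inv_eq hgb
    · exact fun h => M.hab (M.ι_eq_c.1 h)
  have hc' : M.ι 0 M.c ∈ ⇑((g * M.t)⁻¹ : X ≃ₜ X) '' S \ {M.c} := by
    refine ⟨⟨g M.c, hq.1, ?_⟩, ?_⟩
    · apply homeo_inv_eq
      rw [homeo_mul_apply, M.tp0]
    · exact fun h => M.c_ne_b (M.ι_eq_c.1 h)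
  exact (M.sep [] (h3.2.1 M.c) (i := 1) (j := 0) (by simp) hb' hc').2 rfl

theorem assemble (H : Subgroup (X ≃ₜ X)) (g : Fin (N + 3) → (X ≃ₜ X))
    (hb : ∀ i, g i M.b = M.b) (hg : ∀ i, M.E i (g i) ∈ H) :
    ∃ f ∈ H, ∀ i x, f (M.ι i x) = M.ι i (g i x) := by
  have key : ∀ s : Finset (Fin (N + 3)), ∃ f ∈ H, ∀ i x,
      f (M.ι i x) = if i ∈ s then M.ι i (g i x) else M.ι i x := by
    intro s
    induction s using Finset.induction_on with
    | empty => exact ⟨1, H.one_mem, fun i x => by simp⟩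
    | insert j s hj ih =>
      obtain ⟨f, hf, hf2⟩ := ih
      refine ⟨M.E j (g j) * f, H.mul_mem (hg j) hf, fun i x => ?_⟩
      rw [homeo_mul_apply, hf2]
      by_cases hij : i = j
      · subst hij
        rw [if_neg hj, M.E_same _ (hb _), if_pos (Finset.mem_insert_self _ _)]
      · simp only [Finset.mem_insert, hij, false_or]
        split_ifs <;> rw [M.E_ne _ hij]
  obtain ⟨f, hf, hf2⟩ := key Finset.univ
  exact ⟨f, hf, fun i x => by rw [hf2, if_pos (Finset.mem_univ _)]⟩

theorem mem_range_of_fix (h : X ≃ₜ X) (hc : h M.c = M.c) (i) :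
    ∃ j, ∀ x, h (M.ι i x) ∈ Set.range (M.ι j) := by
  obtain ⟨j, y, hy⟩ := M.surj (h (M.ι i M.a))
  refine ⟨j, fun x => ?_⟩
  by_cases hx : x = M.b
  · rw [hx, M.ιb, hc]; exact M.c_mem_range j
  obtain ⟨l, z, hz⟩ := M.surj (h (M.ι i x))
  by_cases hl : l = j
  · rw [hz, hl]; exact ⟨z, rfl⟩
  exfalso
  have hpre := (M.preconn_compl_b.image _ (M.cont i).continuousOn).image h
    h.continuous.continuousOn
  have := M.sep [] hpre hl (x := z) (y := y) ⟨_, ⟨x, hx, rfl⟩, hz⟩ ⟨_, ⟨M.a, M.hab, rfl⟩, hy⟩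
  obtain ⟨_, ⟨p, hp, rfl⟩, hpc⟩ := this
  rw [M.cell_nil] at hpc
  have : M.ι i p = M.c := h.injective (hpc.trans hc.symm)
  exact hp (M.ι_eq_c.1 this)

/-- Structure of homeomorphisms fixing the centre. -/
theorem structure_fix (h : X ≃ₜ X) (hc : h M.c = M.c) :
    ∃ (π : Equiv.Perm (Fin (N + 3))) (k : Fin (N + 3) → (X ≃ₜ X)), (∀ i, k i M.b = M.b) ∧
      ∀ i x, h (M.ι i x) = M.ι (π i) (k i x) := by
  have hc' : h⁻¹ M.c = M.c := homeo_inv_eq hc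
  choose f hf using M.mem_range_of_fix h hc
  choose g hg using M.mem_range_of_fix h⁻¹ hc'
  choose F hF using hf
  choose K hK using hg
  have e1 : ∀ i x, M.ι (g (f i)) (K (f i) (F i x)) = M.ι i x := by
    intro i x
    rw [hK, hF, homeo_inv_apply_self]
  have e2 : ∀ i x, M.ι (f (g i)) (F (g i) (K i x)) = M.ι i x := by
    intro i x
    rw [hF, hK, homeo_apply_inv_self]
  have gf : ∀ i, g (f i) = i := by
    intro i
    rcases M.inj' (e1 i M.a) with h | h
    · exact h.1
    · exact absurd h.2 M.hab
  have fg : ∀ i, f (g i) = i := by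
    intro i
    rcases M.inj' (e2 i M.a) with h | h
    · exact h.1
    · exact absurd h.2 M.hab
  have KF : ∀ i x, K (f i) (F i x) = x := by
    intro i x
    have := e1 i x
    rw [gf] at this
    exact M.inj this
  have FK : ∀ i x, F i (K (f i) x) = x := by
    intro i x
    have := e2 (f i) x
    rw [fg, gf] at this
    exact M.inj this
  have cF : ∀ i, Continuous (F i) := by
    intro i
    rw [(M.isClosedEmb (f i)).isInducing.continuous_iff]
    have : M.ι (f i) ∘ F i = h ∘ M.ι i := funext fun x => hF i x
    rw [this]
    exact h.continuous.comp (M.cont i)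
  have cK : ∀ i, Continuous (K i) := by
    intro i
    rw [(M.isClosedEmb (g i)).isInducing.continuous_iff]
    have : M.ι (g i) ∘ K i = ⇑(h⁻¹ : X ≃ₜ X) ∘ M.ι i := funext fun x => hK i x
    rw [this]
    exact (h⁻¹).continuous.comp (M.cont i)
  refine ⟨⟨f, g, gf, fg⟩, fun i => ⟨⟨F i, K (f i), KF i, FK i⟩, cF i, cK _⟩, fun i => ?_,
    fun i x => (hF i x).symm⟩
  change F i M.b = M.b
  have := hF i M.b
  rw [M.ιb, hc] at this
  exact M.ι_eq_c.1 this

/-- Approximation up to the cells of level `k`. -/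
def Approx (k : ℕ) (g h : X ≃ₜ X) : Prop :=
  ∀ w : List (Fin (N + 3)), w.length = k → ∀ x, ∃ y, g (M.cell w x) = h (M.cell w y)

theorem approx_step (H : Subgroup (X ≃ₜ X)) (m : ℕ) (h g₀ : X ≃ₜ X) (hg₀ : g₀ ∈ H)
    (hg₀c : g₀ M.c = h M.c)
    (hyp : ∀ (π : Equiv.Perm (Fin (N + 3))) (k : Fin (N + 3) → (X ≃ₜ X)),
      (∀ i, k i M.b = M.b) → (∀ i x, (g₀⁻¹ * h) (M.ι i x) = M.ι (π i) (k i x)) →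
      M.P π ∈ H ∧ ∀ i, ∃ g : X ≃ₜ X, g M.b = M.b ∧ M.E i g ∈ H ∧ M.Approx m g (k i)) :
    ∃ g ∈ H, M.Approx (m + 1) g h := by
  obtain ⟨π, k, hkb, hk⟩ := M.structure_fix (g₀⁻¹ * h) (by
    rw [homeo_mul_apply]; exact homeo_inv_eq hg₀c)
  obtain ⟨hπ, h2⟩ := hyp π k hkb hk
  choose g hgb hgE hgA using h2
  obtain ⟨f, hf, hf2⟩ := M.assemble H g hgb hgE
  refine ⟨g₀ * (M.P π * f), H.mul_mem hg₀ (H.mul_mem hπ hf), ?_⟩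
  intro w hw x
  cases w with
  | nil => simp at hw
  | cons i w =>
    obtain ⟨y, hy⟩ := hgA i w (by simpa using hw) x
    refine ⟨y, ?_⟩
    simp only [homeo_mul_apply, M.cell_cons]
    rw [hf2, M.P_apply, hy, ← hk, homeo_mul_apply, homeo_apply_inv_self]

theorem fix_aux {π : Equiv.Perm (Fin (N + 3))} {k : Fin (N + 3) → (X ≃ₜ X)} {h : X ≃ₜ X}
    (hk : ∀ i x, h (M.ι i x) = M.ι (π i) (k i x)) {i} (hi : h (M.ι i M.a) = M.ι i M.a) :
    π i = i ∧ k i M.a = M.a := by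
  rw [hk] at hi
  rcases M.inj' hi with h | h
  · exact h
  · exact absurd h.2 M.hab

theorem approx12 (m : ℕ) :
    (∀ h : X ≃ₜ X, h M.b = M.b → ∃ g ∈ M.N1, M.Approx m g h) ∧
    (∀ h : X ≃ₜ X, h M.a = M.a → h M.b = M.b → ∃ g ∈ M.N2, M.Approx m g h) := by
  induction m with
  | zero =>
    have : ∀ h : X ≃ₜ X, M.Approx 0 1 h := by
      intro h w hw x
      rw [List.length_eq_zero_iff] at hw
      subst hw
      exact ⟨h⁻¹ x, (homeo_apply_inv_self h x).symm⟩
    exact ⟨fun h _ => ⟨1, M.N1.one_mem, this h⟩, fun h _ _ => ⟨1, M.N2.one_mem, this h⟩⟩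
  | succ m ih =>
    obtain ⟨ih1, ih2⟩ := ih
    constructor
    · intro h hb
      obtain ⟨g₀, hg₀, hg₀c⟩ := M.trans1' (M.br_homeo h .c)
      refine M.approx_step M.N1 m h g₀ hg₀ hg₀c fun π k hkb hk => ?_
      have f1 := M.fix_aux hk (i := 1) (by
        rw [M.endA, homeo_mul_apply, hb]; exact homeo_inv_eq (N1.b hg₀))
      refine ⟨M.P_mem_N1 f1.1, fun i => ?_⟩
      by_cases hi : i = 1
      · subst hi
        obtain ⟨g, hg, hA⟩ := ih2 (k 1) f1.2 (hkb 1)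
        exact ⟨g, N2.b hg, M.E1_mem_N1 hg, hA⟩
      · obtain ⟨g, hg, hA⟩ := ih1 (k i) (hkb i)
        exact ⟨g, N1.b hg, M.E_mem_N1 hg hi, hA⟩
    · intro h ha hb
      obtain ⟨g₀, hg₀, hg₀c⟩ := M.trans2 h ha hb
      refine M.approx_step M.N2 m h g₀ hg₀ hg₀c fun π k hkb hk => ?_
      have f1 := M.fix_aux hk (i := 1) (by
        rw [M.endA, homeo_mul_apply, hb]; exact homeo_inv_eq (N2.b hg₀))
      have f0 := M.fix_aux hk (i := 0) (by
        rw [M.fixA, homeo_mul_apply, ha]; exact homeo_inv_eq (N2.a hg₀))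
      refine ⟨M.P_mem_N2 f0.1 f1.1, fun i => ?_⟩
      by_cases hi : i = 1
      · subst hi
        obtain ⟨g, hg, hA⟩ := ih2 (k 1) f1.2 (hkb 1)
        exact ⟨g, N2.b hg, M.E1_mem_N2 hg, hA⟩
      by_cases hi0 : i = 0
      · subst hi0
        obtain ⟨g, hg, hA⟩ := ih2 (k 0) f0.2 (hkb 0)
        exact ⟨g, N2.b hg, M.E0_mem_N2 hg, hA⟩
      · obtain ⟨g, hg, hA⟩ := ih1 (k i) (hkb i)
        exact ⟨g, N1.b hg, M.Ej_mem_N2 hg hi0 hi, hA⟩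

theorem approx0 (m : ℕ) (h : X ≃ₜ X) : ∃ g ∈ M.G, M.Approx (m + 1) g h := by
  obtain ⟨g₀, hg₀, hg₀c⟩ := M.trans0 (M.br_homeo h .c)
  refine M.approx_step M.G m h g₀ hg₀ hg₀c fun π k hkb hk => ⟨M.P_mem_G π, fun i => ?_⟩
  obtain ⟨g, hg, hA⟩ := (M.approx12 m).1 (k i) (hkb i)
  exact ⟨g, N1.b hg, M.E_mem_G hg i, hA⟩

/-- Refinement of `Approx`. -/
theorem Approx.mono {M : WModel N X} {m l : ℕ} (hml : l ≤ m) {g h : X ≃ₜ X}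
    (hA : M.Approx m g h) : M.Approx l g h := by
  intro w hw x
  obtain ⟨v, y, hv, rfl⟩ := M.cell_surj (m - l) x
  obtain ⟨z, hz⟩ := hA (w ++ v) (by simp [hw, hv]; omega) y
  rw [M.cell_append, M.cell_append] at hz
  exact ⟨_, hz⟩

theorem dense_G : Dense (M.G : Set (X ≃ₜ X)) := by
  intro h
  have hind : IsInducing (fun h : X ≃ₜ X => (h : C(X, X))) := ⟨rfl⟩
  choose g hg hA using fun m => M.approx0 m h
  refine mem_closure_of_tendsto (f := g) (b := Filter.atTop) ?_ (Filter.Eventually.of_forall hg)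
  rw [hind.tendsto_nhds_iff, ContinuousMap.tendsto_nhds_compactOpen]
  intro K hK U hU hKU
  obtain ⟨k, hk⟩ := M.leb (U := h ⁻¹' U) (K := K) (hU.preimage h.continuous) hK.isClosed hKU
  filter_upwards [Filter.eventually_ge_atTop k] with m hm x hx
  obtain ⟨w, y, hw, rfl⟩ := M.cell_surj k x
  obtain ⟨z, hz⟩ := (hA m).mono (hm.trans (Nat.le_succ m)) w hw y
  change g m (M.cell w y) ∈ U
  rw [hz]
  exact hk w hw ⟨y, hx⟩ z

/-- Finitely many orbits. -/
def Oli (H : Subgroup (X ≃ₜ X)) (m : ℕ) : Prop :=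
  ∃ B : Set X, B.Finite ∧ (∀ x ∈ B, M.Br x) ∧ ∀ F : Set X, F.Finite → F.ncard ≤ m →
    (∀ x ∈ F, M.Br x) → ∃ g ∈ H, ∀ x ∈ F, g x ∈ B

theorem oli_zero (H : Subgroup (X ≃ₜ X)) : M.Oli H 0 := by
  refine ⟨∅, Set.finite_empty, by simp, fun F hF hF2 _ => ⟨1, H.one_mem, fun x hx => ?_⟩⟩
  rw [Nat.le_zero, Set.ncard_eq_zero hF] at hF2
  rw [hF2] at hx
  exact hx

theorem ncard_pre_le {F : Set X} (hF : F.Finite) (i : Fin (N + 3)) {q : X} (hq : q ∈ F)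
    (hqi : q ∉ M.ι i '' {M.b}ᶜ) {m} (hm : F.ncard ≤ m + 1) :
    (M.ι i ⁻¹' (F \ {M.c})).ncard ≤ m := by
  have h1 : M.ι i '' (M.ι i ⁻¹' (F \ {M.c})) ⊆ F \ {q} := by
    rintro _ ⟨x, hx, rfl⟩
    refine ⟨hx.1, fun h => hqi ?_⟩
    rw [Set.mem_singleton_iff] at h
    rw [← h]
    exact ⟨x, fun hxb => hx.2 (M.ι_eq_c.2 hxb), rfl⟩
  have h2 := Set.ncard_le_ncard h1 (hF.subset Set.diff_subset)
  rw [Set.ncard_image_of_injective _ (fun _ _ h => M.inj h)] at h2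
  rw [Set.ncard_diff_singleton_of_mem hq] at h2
  omega

theorem ncard_pre_le' {F : Set X} (hF : F.Finite) (i : Fin (N + 3)) {m} (hm : F.ncard ≤ m) :
    (M.ι i ⁻¹' (F \ {M.c})).ncard ≤ m := by
  rw [← Set.ncard_image_of_injective _ (fun _ _ h => M.inj h : Function.Injective (M.ι i))]
  refine (Set.ncard_le_ncard ?_ hF).trans hm
  rintro _ ⟨x, hx, rfl⟩
  exact hx.1

theorem oli_step (H : Subgroup (X ≃ₜ X)) (m : ℕ) (B : Set X) (hB : B.Finite)
    (hBbr : ∀ x ∈ B, M.Br x)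
    (hyp : ∀ F : Set X, F.Finite → F.Nonempty → F.ncard ≤ m → (∀ x ∈ F, M.Br x) →
      ∃ g₀ ∈ H, ∀ i, ∃ g : X ≃ₜ X, g M.b = M.b ∧ M.E i g ∈ H ∧
        ∀ x, x ≠ M.b → M.ι i x ∈ g₀ '' F → g x ∈ B) : M.Oli H m := by
  refine ⟨{M.c} ∪ ⋃ i, M.ι i '' B, (Set.finite_singleton _).union
    (Set.finite_iUnion fun i => hB.image _), ?_, ?_⟩
  · rintro x (rfl | hx)
    · exact .c
    · obtain ⟨i, y, hy, rfl⟩ := Set.mem_iUnion.1 hx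
      exact .step i (hBbr y hy)
  · intro F hF hFm hFbr
    rcases F.eq_empty_or_nonempty with rfl | hne
    · exact ⟨1, H.one_mem, fun x hx => hx.elim⟩
    obtain ⟨g₀, hg₀, hg⟩ := hyp F hF hne hFm hFbr
    choose g hgb hgE hgB using hg
    obtain ⟨f, hf, hf2⟩ := M.assemble H g hgb hgE
    refine ⟨f * g₀, H.mul_mem hf hg₀, fun x hx => ?_⟩
    rw [homeo_mul_apply]
    obtain ⟨i, y, hy⟩ := M.surj (g₀ x)
    rw [hy, hf2]
    by_cases hyb : y = M.b
    · left; rw [hyb, hgb, M.ιb]; rfl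
    · right
      exact Set.mem_iUnion.2 ⟨i, _, hgB i y hyb ⟨x, hx, hy⟩, rfl⟩

/-- The points of a cell. -/
theorem oli_cell {H : Subgroup (X ≃ₜ X)} {m : ℕ} {B : Set X}
    (hB : ∀ F : Set X, F.Finite → F.ncard ≤ m → (∀ x ∈ F, M.Br x) → ∃ g ∈ H, ∀ x ∈ F, g x ∈ B)
    {F : Set X} (hF : F.Finite) (hFbr : ∀ x ∈ F, M.Br x) (i : Fin (N + 3))
    (hm : (M.ι i ⁻¹' (F \ {M.c})).ncard ≤ m) :
    ∃ g ∈ H, ∀ x, x ≠ M.b → M.ι i x ∈ F → g x ∈ B := by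
  obtain ⟨g, hg, h⟩ := hB (M.ι i ⁻¹' (F \ {M.c}))
    ((hF.subset Set.diff_subset).preimage (fun _ _ _ _ h => M.inj h)) hm (by
      intro x hx
      rcases (hFbr _ hx.1).of_ι with h | h
      · exact h
      · exact absurd (M.ι_eq_c.2 h) hx.2)
  refine ⟨g, hg, fun x hx hxF => h x ⟨hxF, fun h => hx (M.ι_eq_c.1 h)⟩⟩

theorem oli12 (m : ℕ) : M.Oli M.N1 m ∧ M.Oli M.N2 m := by
  induction m with
  | zero => exact ⟨M.oli_zero _, M.oli_zero _⟩
  | succ m ih =>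
    obtain ⟨⟨B1, fB1, bB1, h1⟩, ⟨B2, fB2, bB2, h2⟩⟩ := ih
    have hN1 : M.Oli M.N1 (m + 1) := by
      refine M.oli_step _ _ (B1 ∪ B2) (fB1.union fB2) (by
        rintro x (hx | hx)
        · exact bB1 x hx
        · exact bB2 x hx) ?_
      rintro F hF ⟨f0, hf0⟩ hFm hFbr
      obtain ⟨g, hg, hgc⟩ := M.trans1' (hFbr f0 hf0)
      refine ⟨g⁻¹, M.N1.inv_mem hg, fun i => ?_⟩
      have hF' := hF.image ⇑(g⁻¹ : X ≃ₜ X)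
      have hFb' : ∀ x ∈ ⇑(g⁻¹ : X ≃ₜ X) '' F, M.Br x := by
        rintro _ ⟨x, hx, rfl⟩
        exact M.br_homeo _ (hFbr x hx)
      have hle := M.ncard_pre_le hF' i (q := M.c) ⟨f0, hf0, homeo_inv_eq hgc⟩
        (by rintro ⟨x, hx, hxc⟩; exact hx (M.ι_eq_c.1 hxc))
        ((Set.ncard_image_le hF).trans hFm)
      by_cases hi : i = 1
      · subst hi
        obtain ⟨k, hk, hkB⟩ := M.oli_cell h2 hF' hFb' 1 hle
        exact ⟨k, N2.b hk, M.E1_mem_N1 hk, fun x hx hxF => Or.inr (hkB x hx hxF)⟩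
      · obtain ⟨k, hk, hkB⟩ := M.oli_cell h1 hF' hFb' i hle
        exact ⟨k, N1.b hk, M.E_mem_N1 hk hi, fun x hx hxF => Or.inl (hkB x hx hxF)⟩
    refine ⟨hN1, ?_⟩
    obtain ⟨B3, fB3, bB3, h3⟩ := hN1
    refine M.oli_step _ _ (B3 ∪ B2) (fB3.union fB2) (by
        rintro x (hx | hx)
        · exact bB3 x hx
        · exact bB2 x hx) ?_
    rintro F hF ⟨f0, hf0⟩ hFm hFbr
    obtain ⟨g, hg, hgc⟩ := M.proj2 (hFbr f0 hf0)
    refine ⟨g, hg, fun i => ?_⟩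
    have hF' := hF.image ⇑g
    have hFb' : ∀ x ∈ ⇑g '' F, M.Br x := by
      rintro _ ⟨x, hx, rfl⟩
      exact M.br_homeo _ (hFbr x hx)
    have hle : i = 0 ∨ i = 1 → _ := fun hi => M.ncard_pre_le hF' i (q := g f0) ⟨f0, hf0, rfl⟩ (by
      rintro ⟨x, hx, hxc⟩
      rcases hgc with hgc | ⟨j, y, h0, h1, hgc⟩
      · exact hx (M.ι_eq_c.1 (hxc.trans hgc))
      · rcases M.inj' (hxc.trans hgc) with h | h
        · rcases hi with hi | hi
          · exact h0 (h.1.symm.trans hi)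
          · exact h1 (h.1.symm.trans hi)
        · exact hx h.1) ((Set.ncard_image_le hF).trans hFm)
    by_cases hi0 : i = 0
    · subst hi0
      obtain ⟨k, hk, hkB⟩ := M.oli_cell h2 hF' hFb' 0 (hle (Or.inl rfl))
      exact ⟨k, N2.b hk, M.E0_mem_N2 hk, fun x hx hxF => Or.inr (hkB x hx hxF)⟩
    by_cases hi : i = 1
    · subst hi
      obtain ⟨k, hk, hkB⟩ := M.oli_cell h2 hF' hFb' 1 (hle (Or.inr rfl))
      exact ⟨k, N2.b hk, M.E1_mem_N2 hk, fun x hx hxF => Or.inr (hkB x hx hxF)⟩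
    · obtain ⟨k, hk, hkB⟩ := M.oli_cell h3 hF' hFb' i
        (M.ncard_pre_le' hF' i ((Set.ncard_image_le hF).trans hFm))
      exact ⟨k, N1.b hk, M.Ej_mem_N2 hk hi0 hi, fun x hx hxF => Or.inl (hkB x hx hxF)⟩

theorem oliG (m : ℕ) : M.Oli M.G m := by
  obtain ⟨B, fB, bB, h⟩ := (M.oli12 m).1
  refine M.oli_step _ _ B fB bB ?_
  rintro F hF - hFm hFbr
  refine ⟨1, M.G.one_mem, fun i => ?_⟩
  have h1 : ⇑(1 : X ≃ₜ X) '' F = F := by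
    ext x; simp
  rw [h1]
  obtain ⟨k, hk, hkB⟩ := M.oli_cell h hF hFbr i (M.ncard_pre_le' hF i hFm)
  exact ⟨k, N1.b hk, M.E_mem_G hk i, hkB⟩

theorem no_circle (M : WModel N X) (S : Set X) : IsEmpty (S ≃ₜ Circle) := by
  refine ⟨fun e => ?_⟩
  let f : Circle → X := fun z => (e.symm z : X)
  have hf : Continuous f := continuous_subtype_val.comp e.symm.continuous
  have hinj : Function.Injective f := Subtype.val_injective.comp e.symm.injective
  have hr : S = f '' Set.univ := by
    ext x
    constructor
    · intro hx
      exact ⟨e ⟨x, hx⟩, trivial, by simp [f]⟩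
    · rintro ⟨z, -, rfl⟩
      exact (e.symm z).2
  have hpt : ∀ z : Circle, IsPreconnected ({z}ᶜ : Set Circle) := by
    intro z
    have : ({z}ᶜ : Set Circle) = (fun θ : ℝ => z * Circle.exp θ) '' Set.Ioo 0 (2 * Real.pi) := by
      ext w
      constructor
      · intro hw
        obtain ⟨θ, hθ, hθw⟩ : ∃ θ ∈ Set.Ico 0 (2 * Real.pi), Circle.exp θ = z⁻¹ * w := by
          have h1 := Circle.periodic_exp.exists_mem_Ico₀ Real.two_pi_pos (Complex.arg (z⁻¹ * w : Circle))
          obtain ⟨y, hy, hy2⟩ := h1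
          exact ⟨y, hy, by rw [← hy2, Circle.exp_arg]⟩
        refine ⟨θ, ⟨lt_of_le_of_ne hθ.1 ?_, hθ.2⟩, ?_⟩
        · rintro rfl
          apply hw
          rw [Circle.exp_zero] at hθw
          exact (inv_mul_eq_one.1 hθw.symm).symm
        · simp [hθw]
      · rintro ⟨θ, hθ, rfl⟩ h
        simp only [Set.mem_singleton_iff, mul_eq_left] at h
        obtain ⟨k, hk⟩ := Circle.exp_eq_one.1 h
        rw [hk] at hθ
        have hpi := Real.two_pi_pos
        have h1 : (0:ℝ) < k := by
          by_contra hh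
          nlinarith [hθ.1]
        have h2 : (k:ℝ) < 1 := by
          by_contra hh
          nlinarith [hθ.2]
        have h1' : 0 < k := by exact_mod_cast h1
        have h2' : k < 1 := by exact_mod_cast h2
        omega
    rw [this]
    exact isPreconnected_Ioo.image _ (by fun_prop)
  have huniv : IsPreconnected (Set.univ : Set Circle) := by
    have : (Set.univ : Set Circle) = Circle.exp '' Set.univ := by
      ext w
      simp only [Set.mem_univ, Set.image_univ, true_iff]
      exact ⟨_, Circle.exp_arg w⟩
    rw [this]
    exact isPreconnected_univ.image _ (by fun_prop)
  have hinf : (Set.univ : Set Circle).Infinite := by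
    have : (Circle.exp '' Set.Ioc (-Real.pi) Real.pi).Infinite :=
      (Set.Ioc_infinite (by linarith [Real.pi_pos])).image (fun x hx y hy h => by
        rw [← Circle.arg_exp hx.1 hx.2, h, Circle.arg_exp hy.1 hy.2])
    exact this.mono (Set.subset_univ _)
  refine no_circ S ?_ ?_ ?_ M
  · rw [hr]; exact huniv.image _ hf.continuousOn
  · intro p
    by_cases hp : p ∈ S
    · obtain ⟨z, -, rfl⟩ := hr ▸ hp
      have : S \ {f z} = f '' {z}ᶜ := by
        rw [hr, ← Set.image_singleton, ← Set.image_diff hinj, Set.compl_eq_univ_diff]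
      rw [this]
      exact (hpt z).image _ hf.continuousOn
    · rw [Set.diff_singleton_eq_self hp, hr]; exact huniv.image _ hf.continuousOn
  · rw [hr]; exact hinf.image hinj.injOn

theorem arc_br (M : WModel N X) (A : Set X) (h : Nonempty (A ≃ₜ unitInterval)) :
    ∃ p ∈ A, ptOrder X p = N + 3 := by
  obtain ⟨e⟩ := h
  have hA : IsPreconnected A := by
    have hr : A = (fun z => (e.symm z : X)) '' Set.univ := by
      ext x
      constructor
      · intro hx
        exact ⟨e ⟨x, hx⟩, trivial, by simp⟩
      · rintro ⟨z, -, rfl⟩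
        exact (e.symm z).2
    rw [hr]
    exact isPreconnected_univ.image _
      (continuous_subtype_val.comp e.symm.continuous).continuousOn
  obtain ⟨p, hp, hb⟩ := M.exists_br hA (e.symm 0).2 (e.symm 1).2 (by
    intro h
    have := e.symm.injective (Subtype.ext h)
    exact zero_ne_one this)
  exact ⟨p, hp, M.ptOrder_br hb⟩

theorem final (M : WModel N X) [TopologicalSpace.MetrizableSpace X] :
    ∃ (_ : IsWazewskiDendrite (N + 3) X)
      (G : Subgroup (X ≃ₜ X)),
      G.FG ∧ Dense (G : Set (X ≃ₜ X)) ∧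
      ∀ m : ℕ, 1 ≤ m →
        ∃ R : Set (Fin m → X), R.Finite ∧
          (∀ r ∈ R, ∀ i, ptOrder X (r i) = N + 3) ∧
          ∀ f : Fin m → X, (∀ i, ptOrder X (f i) = N + 3) →
            ∃ r ∈ R, ∃ g ∈ G, ∀ i, (g : X ≃ₜ X) (r i) = f i := by
  refine ⟨⟨⟨⟨M.a⟩, inferInstance, ?_, M.locConn, inferInstance, M.no_circle⟩, ?_, M.arc_br⟩,
    M.G, M.G_fg, M.dense_G, ?_⟩
  · haveI : Nonempty X := ⟨M.a⟩
    haveI : PreconnectedSpace X := ⟨M.preconn⟩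
    exact ⟨inferInstance⟩
  · intro p
    by_cases hp : M.Br p
    · exact Or.inr (Or.inr (M.ptOrder_br hp))
    · rcases M.ptOrder_not_br hp with h | h
      · exact Or.inl h
      · exact Or.inr (Or.inl h)
  · intro m _
    obtain ⟨B, fB, bB, h⟩ := M.oliG m
    refine ⟨{r | ∀ i, r i ∈ B}, ?_, fun r hr i => M.ptOrder_br (bB _ (hr i)), fun f hf => ?_⟩
    · have := Set.Finite.pi' (ι := Fin m) (t := fun _ => B) (fun _ => fB)
      exact this
    · obtain ⟨g, hg, hgB⟩ := h (Set.range f) (Set.finite_range f) (by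
        rw [← Set.image_univ]
        refine (Set.ncard_image_le Set.finite_univ).trans ?_
        rw [Set.ncard_univ]; simp) (by
        rintro _ ⟨i, rfl⟩
        exact M.br_iff.2 (hf i))
      exact ⟨fun i => g (f i), fun i => hgB _ ⟨i, rfl⟩, g⁻¹, M.G.inv_mem hg,
        fun i => homeo_inv_apply_self _ _⟩

end WModel


/-! ### Quotients of compact metrizable spaces by closed relations -/

section ClosedQuotient

variable {S : Type} [TopologicalSpace S] [CompactSpace S] [T2Space S] (s : Setoid S)

theorem cq_closedMap (hs : IsClosed {p : S × S | s p.1 p.2})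
    : IsClosedMap (Quotient.mk s) := by
  intro C hC
  rw [← isQuotientMap_quotient_mk'.isClosed_preimage]
  have : Quotient.mk s ⁻¹' (Quotient.mk s '' C) =
      Prod.snd '' ({p : S × S | s p.1 p.2} ∩ Prod.fst ⁻¹' C) := by
    ext x
    constructor
    · rintro ⟨y, hy, hyx⟩
      exact ⟨(y, x), ⟨Quotient.exact hyx, hy⟩, rfl⟩
    · rintro ⟨⟨y, x⟩, ⟨h1, h2⟩, rfl⟩
      exact ⟨y, h2, Quotient.sound h1⟩
  change IsClosed (Quotient.mk s ⁻¹' (Quotient.mk s '' C))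
  rw [this]
  exact ((hs.inter (hC.preimage continuous_fst)).isCompact.image continuous_snd).isClosed

/-- the fibre -/
theorem cq_fiber (hs : IsClosed {p : S × S | s p.1 p.2})
    (x : Quotient s) : IsCompact (Quotient.mk s ⁻¹' {x}) := by
  obtain ⟨y, rfl⟩ := Quotient.exists_rep x
  have : Quotient.mk s ⁻¹' {Quotient.mk s y} = (fun z => (z, y)) ⁻¹' {p : S × S | s p.1 p.2} := by
    ext z
    exact Quotient.eq
  rw [this]
  exact (hs.preimage (by fun_prop)).isCompact

theorem cq_kern (hs : IsClosed {p : S × S | s p.1 p.2})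
    {U : Set S} (hU : IsOpen U) : IsOpen (Quotient.mk s '' Uᶜ)ᶜ :=
  (cq_closedMap s hs _ hU.isClosed_compl).isOpen_compl

theorem cq_mem_kern {S : Type} (s : Setoid S) {U : Set S} {x : Quotient s} :
    x ∈ (Quotient.mk s '' Uᶜ)ᶜ ↔ Quotient.mk s ⁻¹' {x} ⊆ U := by
  constructor
  · intro h y hy
    by_contra hU
    exact h ⟨y, hU, hy⟩
  · rintro h ⟨y, hy, hyx⟩
    exact hy (h hyx)

theorem cq_t2 (hs : IsClosed {p : S × S | s p.1 p.2})
    : T2Space (Quotient s) := by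
  refine ⟨fun x y hxy => ?_⟩
  have hd : Disjoint (Quotient.mk s ⁻¹' {x}) (Quotient.mk s ⁻¹' {y}) := by
    rw [Set.disjoint_left]
    intro z hz hz'
    exact hxy (hz.symm.trans hz')
  obtain ⟨U, V, hU, hV, hxU, hyV, hUV⟩ :=
    SeparatedNhds.of_isCompact_isCompact (cq_fiber s hs x) (cq_fiber s hs y) hd
  refine ⟨_, _, cq_kern s hs hU, cq_kern s hs hV, (cq_mem_kern s).2 hxU, (cq_mem_kern s).2 hyV, ?_⟩
  rw [Set.disjoint_left]
  intro z hz hz'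
  obtain ⟨z, rfl⟩ := Quotient.exists_rep z
  exact Set.disjoint_left.1 hUV ((cq_mem_kern s).1 hz rfl) ((cq_mem_kern s).1 hz' rfl)

theorem cq_second (hs : IsClosed {p : S × S | s p.1 p.2})
    [SecondCountableTopology S] : SecondCountableTopology (Quotient s) := by
  let b := TopologicalSpace.countableBasis S
  have hb : TopologicalSpace.IsTopologicalBasis b := TopologicalSpace.isBasis_countableBasis S
  let F : Set (Set (Set S)) := {t | t.Finite ∧ t ⊆ b}
  have hF : F.Countable := Set.countable_setOf_finite_subset (TopologicalSpace.countable_countableBasis S)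
  have hbas : TopologicalSpace.IsTopologicalBasis
      ((fun t : Set (Set S) => (Quotient.mk s '' (⋃₀ t)ᶜ)ᶜ) '' F) := by
    refine TopologicalSpace.isTopologicalBasis_of_isOpen_of_nhds ?_ ?_
    · rintro _ ⟨t, ht, rfl⟩
      exact cq_kern s hs (isOpen_sUnion fun u hu => hb.isOpen (ht.2 hu))
    · intro x U hx hU
      have key : ∃ t ∈ F, Quotient.mk s ⁻¹' {x} ⊆ ⋃₀ t ∧ ⋃₀ t ⊆ Quotient.mk s ⁻¹' U := by
        have hUo : IsOpen (Quotient.mk s ⁻¹' U) := hU.preimage continuous_quot_mk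
        refine (cq_fiber s hs x).induction_on
          (p := fun K => ∃ t ∈ F, K ⊆ ⋃₀ t ∧ ⋃₀ t ⊆ Quotient.mk s ⁻¹' U) ?_ ?_ ?_ ?_
        · exact ⟨∅, ⟨Set.finite_empty, Set.empty_subset _⟩, by simp, by simp⟩
        · rintro K L hKL ⟨t, ht, h1, h2⟩
          exact ⟨t, ht, hKL.trans h1, h2⟩
        · rintro K L ⟨t, ht, h1, h2⟩ ⟨t', ht', h1', h2'⟩
          refine ⟨t ∪ t', ⟨ht.1.union ht'.1, Set.union_subset ht.2 ht'.2⟩, ?_, ?_⟩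
          · rw [Set.sUnion_union]; exact Set.union_subset_union h1 h1'
          · rw [Set.sUnion_union]; exact Set.union_subset h2 h2'
        · intro y hy
          have hyU : y ∈ Quotient.mk s ⁻¹' U := by
            change Quotient.mk s y ∈ U
            rw [show Quotient.mk s y = x from hy]; exact hx
          obtain ⟨u, hu, hyu, huU⟩ := hb.exists_subset_of_mem_open hyU hUo
          exact ⟨u, mem_nhdsWithin_of_mem_nhds ((hb.isOpen hu).mem_nhds hyu), {u},
            ⟨Set.finite_singleton _, by simpa using hu⟩, by simp, by simpa using huU⟩
      obtain ⟨t, ht, h1, h2⟩ := key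
      refine ⟨_, ⟨t, ht, rfl⟩, (cq_mem_kern s).2 h1, ?_⟩
      intro z hz
      obtain ⟨z, rfl⟩ := Quotient.exists_rep z
      exact h2 ((cq_mem_kern s).1 hz rfl)
  exact hbas.secondCountableTopology (hF.image _)

theorem cq_metrizable (hs : IsClosed {p : S × S | s p.1 p.2})
    [SecondCountableTopology S] :
    TopologicalSpace.MetrizableSpace (Quotient s) := by
  have := cq_t2 s hs
  have := cq_second s hs
  exact TopologicalSpace.metrizableSpace_of_t3_secondCountable _

end ClosedQuotient

namespace Addr

variable {N : ℕ}

/-- Prepend a letter. -/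
def cons (i : Fin (N + 3)) (x : ℕ → Fin (N + 3)) : ℕ → Fin (N + 3)
  | 0 => i
  | n + 1 => x n

/-- The zero address. -/
def aS : ℕ → Fin (N + 3) := fun _ => 0

/-- The address of `b`. -/
def bS : ℕ → Fin (N + 3) := cons 1 aS

/-- `x` and `y` are two addresses of a branch point, differing at `p`. -/
def D (p : ℕ) (x y : ℕ → Fin (N + 3)) : Prop :=
  (∀ k, k ≠ p → x k = y k) ∧ x (p + 1) = 1 ∧ ∀ k, p + 1 < k → x k = 0

theorem D.symm {p : ℕ} {x y : ℕ → Fin (N + 3)} (h : D p x y) : D p y x :=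
  ⟨fun k hk => (h.1 k hk).symm, by rw [← h.1 _ (by omega)]; exact h.2.1,
    fun k hk => by rw [← h.1 _ (by omega)]; exact h.2.2 k hk⟩

theorem D.trans {p q : ℕ} {x y z : ℕ → Fin (N + 3)} (h : D p x y) (h' : D q y z) : D p x z := by
  have hpq : p = q := by
    have hs := h.symm
    rcases lt_trichotomy p q with hlt | he | hlt
    · have h1 := hs.2.2 (q + 1) (by omega)
      rw [h'.2.1] at h1
      exact absurd h1 (by simp)
    · exact he
    · have h1 := h'.2.2 (p + 1) (by omega)
      rw [hs.2.1] at h1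
      exact absurd h1 (by simp)
  subst hpq
  exact ⟨fun k hk => (h.1 k hk).trans (h'.1 k hk), h.2⟩

def R (x y : ℕ → Fin (N + 3)) : Prop := x = y ∨ ∃ p, D p x y

/-- The setoid on addresses. -/
def st (N : ℕ) : Setoid (ℕ → Fin (N + 3)) where
  r := R
  iseqv :=
    { refl := fun _ => Or.inl rfl
      symm := by
        rintro x y (rfl | ⟨p, h⟩)
        · exact Or.inl rfl
        · exact Or.inr ⟨p, h.symm⟩
      trans := by
        rintro x y z (rfl | ⟨p, h⟩) (rfl | ⟨q, h'⟩)
        · exact Or.inl rfl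
        · exact Or.inr ⟨q, h'⟩
        · exact Or.inr ⟨p, h⟩
        · exact Or.inr ⟨p, h.trans h'⟩ }

theorem R_iff {x y : ℕ → Fin (N + 3)} : R x y ↔ ∀ p, x p = y p ∨ D p x y := by
  constructor
  · rintro (rfl | ⟨q, h⟩) p
    · exact Or.inl rfl
    · by_cases hp : p = q
      · subst hp; exact Or.inr h
      · exact Or.inl (h.1 p hp)
  · intro h
    by_cases hxy : x = y
    · exact Or.inl hxy
    · obtain ⟨p, hp⟩ := Function.ne_iff.1 hxy
      exact Or.inr ⟨p, (h p).resolve_left hp⟩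

theorem closed_st : IsClosed {p : (ℕ → Fin (N + 3)) × (ℕ → Fin (N + 3)) | st N p.1 p.2} := by
  have : {p : (ℕ → Fin (N + 3)) × (ℕ → Fin (N + 3)) | st N p.1 p.2} =
      {p | ∀ q, p.1 q = p.2 q ∨ ((∀ k, k ≠ q → p.1 k = p.2 k) ∧ p.1 (q + 1) = 1 ∧
        ∀ k, q + 1 < k → p.1 k = 0)} := by
    ext p
    exact R_iff
  rw [this]
  simp only [Set.setOf_forall, Set.setOf_or, Set.setOf_and]
  refine isClosed_iInter fun q => IsClosed.union (isClosed_eq (by fun_prop) (by fun_prop)) ?_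
  refine IsClosed.inter (isClosed_iInter fun k => isClosed_iInter fun _ =>
    isClosed_eq (by fun_prop) (by fun_prop)) (IsClosed.inter (isClosed_eq (by fun_prop)
      (by fun_prop)) (isClosed_iInter fun k => isClosed_iInter fun _ =>
    isClosed_eq (by fun_prop) (by fun_prop)))

theorem cons_surj (x : ℕ → Fin (N + 3)) : x = cons (x 0) (fun n => x (n + 1)) := by
  funext n
  cases n <;> rfl

theorem cons_cont (i : Fin (N + 3)) : Continuous (cons i) := by
  refine continuous_pi fun n => ?_
  cases n with
  | zero => exact continuous_const
  | succ n => exact continuous_apply n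

theorem cons_R {x y : ℕ → Fin (N + 3)} (i) (h : R x y) : R (cons i x) (cons i y) := by
  rcases h with rfl | ⟨p, h⟩
  · exact Or.inl rfl
  · refine Or.inr ⟨p + 1, ?_, h.2.1, ?_⟩
    · intro k hk
      cases k with
      | zero => rfl
      | succ k => exact h.1 k (by omega)
    · intro k hk
      cases k with
      | zero => omega
      | succ k => exact h.2.2 k (by omega)

theorem R_cons {x y : ℕ → Fin (N + 3)} {i j} (h : R (cons i x) (cons j y)) :
    (i = j ∧ R x y) ∨ (x = bS ∧ y = bS) := by
  rcases h with h | ⟨p, h⟩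
  · exact Or.inl ⟨congrFun h 0, Or.inl (funext fun n => congrFun h (n + 1))⟩
  · cases p with
    | zero =>
      right
      have hxy : x = y := funext fun n => h.1 (n + 1) (by omega)
      have hx : x = bS := by
        funext n
        cases n with
        | zero => exact h.2.1
        | succ n => exact h.2.2 (n + 2) (by omega)
      exact ⟨hx, hxy ▸ hx⟩
    | succ p =>
      left
      refine ⟨h.1 0 (by omega), Or.inr ⟨p, fun k hk => h.1 (k + 1) (by omega), h.2.1,
        fun k hk => h.2.2 (k + 1) (by omega)⟩⟩

/-- The space. -/
def Sp (N : ℕ) : Type := Quotient (st N)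

instance : TopologicalSpace (Sp N) := inferInstanceAs (TopologicalSpace (Quotient (st N)))
instance : CompactSpace (Sp N) := inferInstanceAs (CompactSpace (Quotient (st N)))
instance : T2Space (Sp N) := cq_t2 (st N) closed_st
instance : TopologicalSpace.MetrizableSpace (Sp N) := cq_metrizable (st N) closed_st

/-- The quotient map. -/
def mk (x : ℕ → Fin (N + 3)) : Sp N := Quotient.mk (st N) x

theorem mk_cont : Continuous (mk (N := N)) := continuous_quot_mk

/-- The inclusions of the branches. -/
def inc (i : Fin (N + 3)) : Sp N → Sp N := Quotient.map (cons i) fun _ _ h => cons_R i h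

theorem inc_mk (i : Fin (N + 3)) (x) : inc i (mk x) = mk (cons i x) := rfl

theorem foldr_mk (w : List (Fin (N + 3))) (x) :
    w.foldr inc (mk x) = mk (w.foldr cons x) := by
  induction w with
  | nil => rfl
  | cons i w ih => rw [List.foldr_cons, ih]; rfl

theorem foldr_agree (w : List (Fin (N + 3))) (x y) :
    ∀ k < w.length, w.foldr cons x k = w.foldr cons y k := by
  induction w with
  | nil => intro k hk; simp at hk
  | cons i w ih =>
    intro k hk
    cases k with
    | zero => rfl
    | succ k => exact ih k (by simpa using hk)

theorem leb (U K : Set (Sp N)) (hU : IsOpen U) (hK : IsClosed K) (hKU : K ⊆ U) :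
    ∃ k : ℕ, ∀ w : List (Fin (N + 3)),
    w.length = k → (∃ x, w.foldr inc x ∈ K) → ∀ x, w.foldr inc x ∈ U := by
  have key : ∃ k : ℕ, ∀ s ∈ (Set.univ : Set (ℕ → Fin (N + 3))),
      (∀ s', (∀ l < k, s' l = s l) → mk s' ∈ U) ∨ (∀ s', (∀ l < k, s' l = s l) → mk s' ∉ K) := by
    refine isCompact_univ.induction_on (p := fun T : Set (ℕ → Fin (N + 3)) => ∃ k : ℕ, ∀ s ∈ T,
      (∀ s', (∀ l < k, s' l = s l) → mk s' ∈ U) ∨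
      (∀ s', (∀ l < k, s' l = s l) → mk s' ∉ K)) ?_ ?_ ?_ ?_
    · exact ⟨0, by simp⟩
    · rintro T T' hT ⟨k, hk⟩
      exact ⟨k, fun s hs => hk s (hT hs)⟩
    · have mono : ∀ {T : Set (ℕ → Fin (N + 3))} {k m : ℕ}, k ≤ m → (∀ s ∈ T,
          (∀ s', (∀ l < k, s' l = s l) → mk s' ∈ U) ∨
          (∀ s', (∀ l < k, s' l = s l) → mk s' ∉ K)) → (∀ s ∈ T,
          (∀ s', (∀ l < m, s' l = s l) → mk s' ∈ U) ∨
          (∀ s', (∀ l < m, s' l = s l) → mk s' ∉ K)) := by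
        intro T k m hkm h s hs
        rcases h s hs with h | h
        · exact Or.inl fun s' hs' => h s' fun l hl => hs' l (by omega)
        · exact Or.inr fun s' hs' => h s' fun l hl => hs' l (by omega)
      rintro T T' ⟨k, hk⟩ ⟨k', hk'⟩
      refine ⟨max k k', ?_⟩
      rintro s (hs | hs)
      · exact mono (le_max_left _ _) hk s hs
      · exact mono (le_max_right _ _) hk' s hs
    · intro s _
      have cyl : ∀ O : Set (ℕ → Fin (N + 3)), IsOpen O → s ∈ O →
          ∃ k, PiNat.cylinder s k ⊆ O := by
        intro O hO hs
        obtain ⟨_, ⟨x, k, rfl⟩, h1, h2⟩ :=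
          (PiNat.isTopologicalBasis_cylinders (fun _ => Fin (N + 3))).exists_subset_of_mem_open hs hO
        refine ⟨k, ?_⟩
        rw [← PiNat.mem_cylinder_iff_eq.1 h1] at h2
        exact h2
      by_cases hs : mk s ∈ K
      · obtain ⟨k, hk⟩ := cyl _ (hU.preimage mk_cont) (hKU hs)
        refine ⟨_, mem_nhdsWithin_of_mem_nhds ((PiNat.isOpen_cylinder _ s k).mem_nhds
          (PiNat.self_mem_cylinder s k)), k, fun t ht => Or.inl fun s' hs' => hk fun l hl => ?_⟩
        rw [hs' l hl, ht l hl]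
      · obtain ⟨k, hk⟩ := cyl _ (hK.isOpen_compl.preimage mk_cont) hs
        refine ⟨_, mem_nhdsWithin_of_mem_nhds ((PiNat.isOpen_cylinder _ s k).mem_nhds
          (PiNat.self_mem_cylinder s k)), k, fun t ht => Or.inr fun s' hs' => hk fun l hl => ?_⟩
        rw [hs' l hl, ht l hl]
  obtain ⟨k, hk⟩ := key
  refine ⟨k, ?_⟩
  rintro w hw ⟨x, hx⟩ y
  obtain ⟨x, rfl⟩ := Quotient.exists_rep x
  obtain ⟨y, rfl⟩ := Quotient.exists_rep y
  change w.foldr inc (mk x) ∈ K at hx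
  change w.foldr inc (mk y) ∈ U
  rw [foldr_mk] at hx ⊢
  rcases hk (w.foldr cons x) trivial with h | h
  · exact h _ (fun l hl => foldr_agree w y x l (by omega))
  · exact absurd hx (h _ fun _ _ => rfl)

/-- The concrete model. -/
def model (N : ℕ) : WModel N (Sp N) where
  ι := inc
  a := mk aS
  b := mk bS
  cont i := Continuous.quotient_map' (cons_cont i) _
  inj' := by
    intro i j x y h
    obtain ⟨x, rfl⟩ := Quotient.exists_rep x
    obtain ⟨y, rfl⟩ := Quotient.exists_rep y
    rcases R_cons (Quotient.exact h) with h | h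
    · exact Or.inl ⟨h.1, Quotient.sound h.2⟩
    · rw [h.1, h.2]
      exact Or.inr ⟨rfl, rfl⟩
  surj := by
    intro x
    obtain ⟨x, rfl⟩ := Quotient.exists_rep x
    refine ⟨x 0, mk fun n => x (n + 1), ?_⟩
    rw [inc_mk, ← cons_surj]
    rfl
  ιb' := by
    intro i j
    refine Quotient.sound (Or.inr ⟨0, ?_, rfl, ?_⟩)
    · intro k hk
      cases k with
      | zero => exact absurd rfl hk
      | succ k => rfl
    · intro k hk
      match k, hk with
      | k + 2, _ => rfl
  fixA := by
    rw [inc_mk]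
    congr 1
    funext n
    cases n <;> rfl
  endA := rfl
  hab := by
    intro h
    rcases Quotient.exact h with h | ⟨p, h⟩
    · have := congrFun h 0
      simp [aS, bS, cons] at this
    · have := h.2.1
      simp [aS] at this
  leb' := leb

end Addr

theorem statement10 (n : ℕ) (hn : 3 ≤ n) :
    ∃ (X : Type) (_ : TopologicalSpace X) (_ : IsWazewskiDendrite n X)
      (G : Subgroup (X ≃ₜ X)),
      G.FG ∧ Dense (G : Set (X ≃ₜ X)) ∧
      ∀ m : ℕ, 1 ≤ m →
        ∃ R : Set (Fin m → X), R.Finite ∧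
          (∀ r ∈ R, ∀ i, ptOrder X (r i) = n) ∧
          ∀ f : Fin m → X, (∀ i, ptOrder X (f i) = n) →
            ∃ r ∈ R, ∃ g ∈ G, ∀ i, (g : X ≃ₜ X) (r i) = f i := by
  obtain ⟨N, rfl⟩ : ∃ N, n = N + 3 := ⟨n - 3, by omega⟩
  exact ⟨Addr.Sp N, inferInstance, (Addr.model N).final⟩
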